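/- Every delay game with a Borel winning condition is determined: for every Borel L ⊆ (Σ_I × Σ_O)^ω and every delay function f, either Player I or Player O has a winning strategy in Γ_f(L). -/

import Mathlib

open scoped Classical MeasureTheory

section DelayGames

variable {I O A B : Type}

/-- `shiftSeq f β = ▷^{f 0 - 1} β 0 ▷^{f 1 - 1} β 1 ⋯`, where the skip symbol `▷`
is modeled by `none` and a letter `b ∈ Σ_O` by `some b`. -/
noncomputable def shiftSeq (f : ℕ → ℕ) (β : ℕ → O) : ℕ → Option O := fun n =>
  if h : ∃ i, (∑ j ∈ Finset.range (i + 1), f j) = n + 1 then some (β (Nat.find h))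
  else none

/-- `shift_f(L) = { (α, shift_f(β)) : (α, β) ∈ L }`. -/
def shiftLang (f : ℕ → ℕ) (L : Set ((ℕ → I) × (ℕ → O))) :
    Set ((ℕ → I) × (ℕ → Option O)) :=
  {p | ∃ β : ℕ → O, (p.1, β) ∈ L ∧ p.2 = shiftSeq f β}

/-- The morphism `h` erasing the skip symbol, applied to an infinite word
(meaningful when the word has infinitely many non-skip letters). -/
noncomputable def eraseSkips [Inhabited O] (β : ℕ → Option O) : ℕ → O := fun n =>
  (β (Nat.nth (fun k => (β k).isSome) n)).getD default

/-- `skip(L) = ⋃_f shift_f(L) = { (α,β) : β has infinitely many non-▷ letters and (α, h β) ∈ L }`. -/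
def skipLang [Inhabited O] (L : Set ((ℕ → I) × (ℕ → O))) :
    Set ((ℕ → I) × (ℕ → Option O)) :=
  {p | {k | (p.2 k).isSome}.Infinite ∧ (p.1, eraseSkips p.2) ∈ L}

/-- A play of a Gale-Stewart game is consistent with the Player O strategy `σ`. -/
def gsConsO (σ : List A → B) (α : ℕ → A) (β : ℕ → B) : Prop :=
  ∀ i, β i = σ (List.ofFn fun j : Fin (i + 1) => α j)

/-- A play of a Gale-Stewart game is consistent with the Player I strategy `τ`. -/
def gsConsI (τ : List B → A) (α : ℕ → A) (β : ℕ → B) : Prop :=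
  ∀ i, α i = τ (List.ofFn fun j : Fin i => β j)

/-- `σ` is a winning strategy for Player O in the Gale-Stewart game with winning condition `W`. -/
def gsWinO (W : Set ((ℕ → A) × (ℕ → B))) (σ : List A → B) : Prop :=
  ∀ α β, gsConsO σ α β → (α, β) ∈ W

/-- `τ` is a winning strategy for Player I in the Gale-Stewart game with winning condition `W`. -/
def gsWinI (W : Set ((ℕ → A) × (ℕ → B))) (τ : List B → A) : Prop :=
  ∀ α β, gsConsI τ α β → (α, β) ∉ W

/-- The infinite word `u 0 · u 1 · u 2 ⋯` built by Player I in a delay game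
(well-defined at position `n` as soon as the first `n+1` blocks have more than `n` letters). -/
def outcomeI [Inhabited I] (u : ℕ → List I) : ℕ → I := fun n =>
  ((List.ofFn fun j : Fin (n + 1) => u j).flatten).getD n default

/-- The word `v 0 ⋯ v (i-1)` of the first `i` letters of `v`. -/
def prefixW (v : ℕ → O) (i : ℕ) : List O := List.ofFn fun j : Fin i => v j

/-- The concatenation `u 0 · u 1 ⋯ u i` of Player I's moves up to round `i`. -/
def inputsUpTo (u : ℕ → List I) (i : ℕ) : List I :=
  (List.ofFn fun j : Fin (i + 1) => u j).flatten

/-- `τ : Σ_O^* → Σ_I^*` is a (syntactically valid) Player I strategy for the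
delay game `Γ_f(L)`: it answers with `f i` letters in round `i`. -/
def delayStratI (f : ℕ → ℕ) (τ : List O → List I) : Prop :=
  ∀ w : List O, (τ w).length = f w.length

/-- `τ` is winning for Player I in the delay game `Γ_f(L)`. -/
def delayWinI [Inhabited I] (f : ℕ → ℕ) (L : Set ((ℕ → I) × (ℕ → O)))
    (τ : List O → List I) : Prop :=
  ∀ (u : ℕ → List I) (v : ℕ → O), (∀ i, (u i).length = f i) →
    (∀ i, u i = τ (prefixW v i)) → (outcomeI u, v) ∉ L

/-- `σ : Σ_I^* → Σ_O` is winning for Player O in the delay game `Γ_f(L)`. -/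
def delayWinO [Inhabited I] (f : ℕ → ℕ) (L : Set ((ℕ → I) × (ℕ → O)))
    (σ : List I → O) : Prop :=
  ∀ (u : ℕ → List I) (v : ℕ → O), (∀ i, (u i).length = f i) →
    (∀ i, v i = σ (inputsUpTo u i)) → (outcomeI u, v) ∈ L

/-- A round-counting strategy `σ : Σ_I^* × ℕ → Σ_O` is winning for Player O in `Γ_f(L)`:
in round `i` Player O plays `σ (u 0 ⋯ u i) i`. -/
def rcWinO [Inhabited I] (f : ℕ → ℕ) (L : Set ((ℕ → I) × (ℕ → O)))
    (σ : List I → ℕ → O) : Prop :=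
  ∀ (u : ℕ → List I) (v : ℕ → O), (∀ i, (u i).length = f i) →
    (∀ i, v i = σ (inputsUpTo u i) i) → (outcomeI u, v) ∈ L

/-- An output-tracking strategy `τ : Σ_O^* → Σ_I^ω` is winning for Player I in `Γ_f(L)`:
in round `i` Player I plays the length-`f i` prefix of `τ (v 0 ⋯ v (i-1))`. -/
def otWinI [Inhabited I] (f : ℕ → ℕ) (L : Set ((ℕ → I) × (ℕ → O)))
    (τ : List O → ℕ → I) : Prop :=
  ∀ (u : ℕ → List I) (v : ℕ → O),
    (∀ i, u i = List.ofFn fun j : Fin (f i) => τ (prefixW v i) j) →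
    (outcomeI u, v) ∉ L

/-- A lookahead-counting strategy `τ : Σ_O^* × ℕ → Σ_I^ω` is winning for Player I in `Γ_f(L)`:
in round `i` Player I plays the length-`f i` prefix of `τ (v 0 ⋯ v (i-1), Σ_{j<i} f j)`. -/
def lcWinI [Inhabited I] (f : ℕ → ℕ) (L : Set ((ℕ → I) × (ℕ → O)))
    (τ : List O → ℕ → ℕ → I) : Prop :=
  ∀ (u : ℕ → List I) (v : ℕ → O),
    (∀ i, u i = List.ofFn fun j : Fin (f i) =>
      τ (prefixW v i) (∑ k ∈ Finset.range i, f k) j) →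
    (outcomeI u, v) ∉ L

/-- A history-tracking strategy `τ : Σ_O^* × (ℕ_{>0})^* → Σ_I^ω` is winning for Player I
in `Γ_f(L)`: in round `i` Player I plays the length-`f i` prefix of
`τ (v 0 ⋯ v (i-1), f 0 ⋯ f (i-1))`. -/
def htWinI [Inhabited I] (f : ℕ → ℕ) (L : Set ((ℕ → I) × (ℕ → O)))
    (τ : List O → List ℕ → ℕ → I) : Prop :=
  ∀ (u : ℕ → List I) (v : ℕ → O),
    (∀ i, u i = List.ofFn fun j : Fin (f i) => τ (prefixW v i) (prefixW f i) j) →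
    (outcomeI u, v) ∉ L

/-- `f ⊑ f'` : in every round, the lookahead granted by `f'` is at least that granted by `f`. -/
def delayLE (f f' : ℕ → ℕ) : Prop :=
  ∀ i, (∑ j ∈ Finset.range (i + 1), f j) ≤ ∑ j ∈ Finset.range (i + 1), f' j

end DelayGames


namespace BD

structure GT where
  Pos : Type
  len : Pos → ℕ
  par : Pos → Pos
  len_par : ∀ s, len (par s) = len s - 1
  next : Pos → Pos
  par_next : ∀ s, par (next s) = s
  len_next : ∀ s, len (next s) = len s + 1

def GT.Ch (T : GT) (t s : T.Pos) : Prop := T.par t = s ∧ T.len t = T.len s + 1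

structure Strat (T : GT) where
  f : T.Pos → T.Pos
  ch : ∀ s, T.Ch (f s) s

structure Play (T : GT) where
  x : ℕ → T.Pos
  len : ∀ n, T.len (x n) = n
  par : ∀ n, T.par (x (n+1)) = x n

theorem Play.ext' {T : GT} {x y : Play T} (h : ∀ n, x.x n = y.x n) : x = y := by
  cases x; cases y; simp only [Play.mk.injEq]; exact funext h

def tn (p : Bool) (n : ℕ) : Prop := n % 2 = cond p 1 0

theorem tn_true (n : ℕ) : tn true n ↔ n % 2 = 1 := Iff.rfl
theorem tn_false (n : ℕ) : tn false n ↔ n % 2 = 0 := Iff.rfl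

def Cons {T : GT} (p : Bool) (σ : Strat T) (x : Play T) : Prop :=
  ∀ n, tn p n → x.x (n+1) = σ.f (x.x n)

def IsOp {T : GT} (A : Set (Play T)) : Prop :=
  ∀ x ∈ A, ∃ n, ∀ y : Play T, y.x n = x.x n → y ∈ A

def Clop {T : GT} (A : Set (Play T)) : Prop := IsOp A ∧ IsOp Aᶜ

structure Hm (T' T : GT) where
  f : T'.Pos → T.Pos
  len : ∀ s, T.len (f s) = T'.len s
  par : ∀ s, T.par (f s) = f (T'.par s)

def Hm.play {T' T : GT} (h : Hm T' T) (x : Play T') : Play T where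
  x := fun n => h.f (x.x n)
  len := fun n => by rw [h.len, x.len]
  par := fun n => by rw [h.par, x.par]

def Hm.comp {T'' T' T : GT} (h : Hm T' T) (g : Hm T'' T') : Hm T'' T where
  f := fun s => h.f (g.f s)
  len := fun s => by rw [h.len, g.len]
  par := fun s => by rw [h.par, g.par]

def Hm.id (T : GT) : Hm T T := ⟨fun s => s, fun _ => rfl, fun _ => rfl⟩

theorem IsOp.pre {T' T : GT} (h : Hm T' T) {A : Set (Play T)} (hA : IsOp A) :
    IsOp (h.play ⁻¹' A) := by
  intro x hx
  obtain ⟨n, hn⟩ := hA _ hx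
  refine ⟨n, fun y hy => hn _ ?_⟩
  show h.f _ = h.f _
  rw [hy]

theorem Clop.pre {T' T : GT} (h : Hm T' T) {A : Set (Play T)} (hA : Clop A) :
    Clop (h.play ⁻¹' A) := ⟨hA.1.pre h, hA.2.pre h⟩

/-- Agreement of strategies at levels below `n`. -/
def Agr {T : GT} (n : ℕ) (σ τ : Strat T) : Prop := ∀ s, T.len s < n → σ.f s = τ.f s

structure Cov (k : ℕ) (T' T : GT) where
  h : Hm T' T
  φ : Bool → Strat T' → Strat T
  loc : ∀ p n σ τ, Agr n σ τ → Agr n (φ p σ) (φ p τ)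
  idk : ∀ p σ q, T'.len q < k → (φ p σ).f (h.f q) = h.f (σ.f q)
  inj : ∀ s s', T'.len s ≤ k → h.f s = h.f s' → s = s'
  surj : ∀ s, T.len s ≤ k → ∃ s', h.f s' = s
  lift : ∀ p σ (x : Play T), Cons p (φ p σ) x → ∃ y : Play T', Cons p σ y ∧ h.play y = x

def Cov.comp {k : ℕ} {T'' T' T : GT} (c : Cov k T' T) (d : Cov k T'' T') : Cov k T'' T where
  h := c.h.comp d.h
  φ := fun p σ => c.φ p (d.φ p σ)
  loc := fun p n σ τ hh => c.loc p n _ _ (d.loc p n _ _ hh)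
  idk := fun p σ q hq => by
    show (c.φ p (d.φ p σ)).f (c.h.f (d.h.f q)) = c.h.f (d.h.f _)
    rw [c.idk _ _ _ (by rw [d.h.len]; exact hq), d.idk _ _ _ hq]
  inj := fun s s' hs e => d.inj _ _ hs (c.inj _ _ (by rw [d.h.len]; exact hs) e)
  surj := fun s hs => by
    obtain ⟨a, rfl⟩ := c.surj s hs
    obtain ⟨b, rfl⟩ := d.surj a (by rw [← c.h.len]; exact hs)
    exact ⟨b, rfl⟩
  lift := fun p σ x hx => by
    obtain ⟨y, hy, rfl⟩ := c.lift _ _ _ hx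
    obtain ⟨z, hz, rfl⟩ := d.lift _ _ _ hy
    exact ⟨z, hz, rfl⟩

/-- Universally unravelable. -/
def UU {T : GT} (A : Set (Play T)) : Prop :=
  ∀ (T' : GT) (h : Hm T' T) (k : ℕ), ∃ (T'' : GT) (c : Cov k T'' T'),
    Clop ((h.comp c.h).play ⁻¹' A)

/-! reachability -/
section reach
variable (T : GT) (S U : Set T.Pos) (p : Bool)

inductive Win : Ordinal.{0} → T.Pos → Prop
  | base (α s) : s ∈ S → s ∈ U → Win α s
  | mine (α β s t) : s ∈ S → tn p (T.len s) → T.Ch t s → β < α → Win β t → Win α s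
  | opp (α s) (β : T.Pos → Ordinal.{0}) : s ∈ S → ¬ tn p (T.len s) →
      (∀ t, T.Ch t s → t ∈ S → β t < α) → (∀ t, T.Ch t s → t ∈ S → Win (β t) t) → Win α s

theorem reach : ∃ (W : Set T.Pos) (ρ : Strat T), W ⊆ S ∧ (∀ s ∈ S, s ∈ U → s ∈ W) ∧
    (∀ s ∈ W, s ∉ U → tn p (T.len s) → ρ.f s ∈ W) ∧
    (∀ s ∈ W, s ∉ U → ¬ tn p (T.len s) → ∀ t, T.Ch t s → t ∈ S → t ∈ W) ∧
    (∀ s ∈ S, s ∉ W → tn p (T.len s) → ∀ t, T.Ch t s → t ∉ W) ∧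
    (∀ s ∈ S, s ∉ W → ¬ tn p (T.len s) → ∃ t, T.Ch t s ∧ t ∈ S ∧ t ∉ W) ∧
    (∀ (x : Play T) (N : ℕ), (∀ n, N ≤ n → x.x n ∈ W) → (∀ n, N ≤ n → x.x n ∉ U) →
      (∀ n, N ≤ n → tn p n → x.x (n+1) = ρ.f (x.x n)) → False) := by
  let W : Set T.Pos := {s | ∃ α, Win T S U p α s}
  let rk : T.Pos → Ordinal.{0} := fun s => sInf {α | Win T S U p α s}
  have hrk : ∀ s ∈ W, Win T S U p (rk s) s := fun s hs => csInf_mem (s := {α | Win T S U p α s}) hs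
  have hle : ∀ s α, Win T S U p α s → rk s ≤ α := fun s α h => csInf_le' h
  have h1 : ∀ s ∈ W, s ∉ U → tn p (T.len s) → ∃ t, T.Ch t s ∧ t ∈ W ∧ rk t < rk s := by
    intro s hs hu ht
    have := hrk s hs
    generalize hr : rk s = r at this
    cases this with
    | base _ _ _ h => exact absurd h hu
    | mine _ β _ t _ _ hc hb hw => exact ⟨t, hc, ⟨β, hw⟩, (hle _ _ hw).trans_lt hb⟩
    | opp _ _ _ _ h => exact absurd ht h
  have h2 : ∀ s ∈ W, s ∉ U → ¬ tn p (T.len s) → ∀ t, T.Ch t s → t ∈ S → t ∈ W ∧ rk t < rk s := by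
    intro s hs hu ht t hc hS
    have := hrk s hs
    generalize hr : rk s = r at this
    cases this with
    | base _ _ _ h => exact absurd h hu
    | mine _ β _ t _ h hc hb hw => exact absurd h ht
    | opp _ _ β _ _ hb hw => exact ⟨⟨_, hw t hc hS⟩, (hle _ _ (hw t hc hS)).trans_lt (hb t hc hS)⟩
  have hWS : W ⊆ S := by
    rintro s ⟨α, h⟩
    cases h <;> assumption
  let ρ : Strat T := ⟨fun s => if h : ∃ t, T.Ch t s ∧ t ∈ W ∧ rk t < rk s then h.choose else T.next s,
    fun s => by
      split_ifs with h
      · exact h.choose_spec.1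
      · exact ⟨T.par_next s, T.len_next s⟩⟩
  have hρ : ∀ s ∈ W, s ∉ U → tn p (T.len s) → ρ.f s ∈ W ∧ rk (ρ.f s) < rk s := by
    intro s hs hu ht
    have h := h1 s hs hu ht
    have e : ρ.f s = h.choose := dif_pos h
    rw [e]
    exact h.choose_spec.2
  refine ⟨W, ρ, hWS, fun s hs hu => ⟨0, .base _ _ hs hu⟩, fun s hs hu ht => (hρ s hs hu ht).1,
    fun s hs hu ht t hc hS => (h2 s hs hu ht t hc hS).1, ?_, ?_, ?_⟩
  · rintro s hs hw ht t hc ⟨β, hb⟩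
    exact hw ⟨Order.succ β, .mine _ _ _ _ hs ht hc (Order.lt_succ β) hb⟩
  · intro s hs hw ht
    by_contra hcon
    push Not at hcon
    refine hw ⟨Order.succ (⨆ t, rk t), .opp _ _ rk hs ht (fun t _ _ => ?_) (fun t hc hS => hrk t (hcon t hc hS))⟩
    exact Order.lt_succ_of_le (Ordinal.le_iSup rk t)
  · intro x N hW hU hc
    have hd : ∀ n, rk (x.x (N + (n+1))) < rk (x.x (N + n)) := by
      intro n
      by_cases ht : tn p (N + n)
      · have := hc (N+n) (by omega) ht
        rw [← Nat.add_assoc, this]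
        exact (hρ _ (hW _ (by omega)) (hU _ (by omega)) (by rw [x.len]; exact ht)).2
      · exact (h2 _ (hW (N+n) (by omega)) (hU _ (by omega)) (by rw [x.len]; exact ht) _
          ⟨x.par _, by rw [x.len, x.len]⟩ (hWS (hW _ (by omega)))).2
    exact not_strictAnti_of_wellFoundedLT (fun n => rk (x.x (N + n))) (strictAnti_nat_of_succ_lt hd)
end reach

theorem det_open (T : GT) (root : T.Pos) (hr : ∀ s, T.len s = 0 → s = root) (A : Set (Play T))
    (hA : IsOp A) (p q : Bool) (hpq : ∀ n, tn q n ↔ ¬ tn p n) :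
    (∃ σ, ∀ x, Cons p σ x → x ∈ A) ∨ (∃ σ, ∀ x, Cons q σ x → x ∉ A) := by
  obtain ⟨W, ρ, -, hU, h2, h3, h4, h5, h6⟩ := reach T Set.univ
    {s | ∀ y : Play T, y.x (T.len s) = s → y ∈ A} p
  by_cases hw : root ∈ W
  · left
    refine ⟨ρ, fun x hx => ?_⟩
    by_contra hxA
    have hu : ∀ n, x.x n ∉ {s | ∀ y : Play T, y.x (T.len s) = s → y ∈ A} := by
      intro n h
      exact hxA (h x (by rw [x.len]))
    refine h6 x 0 (fun n _ => ?_) (fun n _ => hu n) (fun n _ => hx n)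
    induction n with
    | zero => rw [hr (x.x 0) (x.len 0)]; exact hw
    | succ n ih =>
      by_cases ht : tn p n
      · rw [hx n ht]; exact h2 _ (ih (by omega)) (hu n) (by rw [x.len]; exact ht)
      · exact h3 _ (ih (by omega)) (hu n) (by rw [x.len]; exact ht) _
          ⟨x.par n, by rw [x.len, x.len]⟩ trivial
  · right
    let τ : Strat T := ⟨fun s => if h : ∃ t, T.Ch t s ∧ t ∉ W then h.choose else T.next s,
      fun s => by
        split_ifs with h
        · exact h.choose_spec.1
        · exact ⟨T.par_next s, T.len_next s⟩⟩
    refine ⟨τ, fun x hx hxA => ?_⟩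
    have hn : ∀ n, x.x n ∉ W := by
      intro n
      induction n with
      | zero => rw [hr (x.x 0) (x.len 0)]; exact hw
      | succ n ih =>
        by_cases ht : tn p n
        · exact h4 _ trivial ih (by rw [x.len]; exact ht) _ ⟨x.par n, by rw [x.len, x.len]⟩
        · rw [hx n ((hpq n).2 ht)]
          obtain ⟨t, ha, -, hb⟩ := h5 _ trivial ih (by rw [x.len]; exact ht)
          have h : ∃ t, T.Ch t (x.x n) ∧ t ∉ W := ⟨t, ha, hb⟩
          have e : τ.f (x.x n) = h.choose := dif_pos h
          rw [e]
          exact h.choose_spec.2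
    obtain ⟨n, hn'⟩ := hA x hxA
    refine hn n (hU _ trivial ?_)
    intro y hy
    exact hn' y (by rw [x.len] at hy; exact hy)

theorem det_UU (T : GT) (root : T.Pos) (hl : T.len root = 0) (hr : ∀ s, T.len s = 0 → s = root)
    (A : Set (Play T)) (hA : UU A) :
    (∃ σ, ∀ x, Cons true σ x → x ∈ A) ∨ (∃ σ, ∀ x, Cons false σ x → x ∉ A) := by
  obtain ⟨T'', c, hc⟩ := hA T (Hm.id T) 0
  obtain ⟨r', hr'⟩ := c.surj root hl.le
  have := det_open T'' r' (fun s hs => c.inj _ _ hs.le (by rw [hr', hr (c.h.f s) (by rw [c.h.len, hs])])) _ hc.1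
    true false (fun n => by rw [tn_true, tn_false]; omega)
  rcases this with ⟨σ, hσ⟩ | ⟨σ, hσ⟩
  · left
    refine ⟨c.φ true σ, fun x hx => ?_⟩
    obtain ⟨y, hy, rfl⟩ := c.lift _ _ _ hx
    exact hσ y hy
  · right
    refine ⟨c.φ false σ, fun x hx => ?_⟩
    obtain ⟨y, hy, rfl⟩ := c.lift _ _ _ hx
    exact hσ y hy

end BD

namespace BD

section limit
variable (T : ℕ → GT) (k : ℕ)

theorem coh_exists (m : ℕ) : ∀ (T : ℕ → GT) (h : ∀ m, Hm (T (m+1)) (T m)) (n : ℕ)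
    (_ : ∀ j, m ≤ j → ∀ s, (T j).len s = n → ∃ s', (h j).f s' = s)
    (t : (T m).Pos) (_ : (T m).len t = n),
    ∃ s : ∀ j, (T j).Pos, (∀ j, (h j).f (s (j+1)) = s j) ∧ s m = t := by
  induction m with
  | zero =>
    intro T h n hs t ht
    choose g hg using hs
    let s : ∀ j, {s : (T j).Pos // (T j).len s = n} := fun j =>
      Nat.rec (motive := fun j => {s : (T j).Pos // (T j).len s = n}) ⟨t, ht⟩
        (fun j s => ⟨g j (Nat.zero_le _) s.1 s.2, by rw [← (h j).len, hg]; exact s.2⟩) j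
    exact ⟨fun j => (s j).1, fun j => hg j _ _ _, rfl⟩
  | succ m ih =>
    intro T h n hs t ht
    obtain ⟨s, h1, h2⟩ := ih (fun j => T (j+1)) (fun j => h (j+1)) n
      (fun j hj => hs (j+1) (by omega)) t ht
    refine ⟨fun j => Nat.casesOn (motive := fun j => (T j).Pos) j ((h 0).f (s 0)) s, ?_, h2⟩
    intro j
    cases j with
    | zero => rfl
    | succ j => exact h1 j

variable {T k} (c : ∀ m, Cov (k+m) (T (m+1)) (T m))

abbrev LPos : Type := {s : ∀ j, (T j).Pos // ∀ j, (c j).h.f (s (j+1)) = s j}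

theorem LPos.len (q : LPos c) (m : ℕ) : (T m).len (q.1 m) = (T 0).len (q.1 0) := by
  induction m with
  | zero => rfl
  | succ m ih => rw [← ih, ← q.2 m, (c m).h.len]

theorem LPos.inj (q q' : LPos c) (m : ℕ) (hl : (T 0).len (q.1 0) ≤ k + m) (e : q.1 m = q'.1 m) :
    q = q' := by
  apply Subtype.ext
  funext j
  have up : ∀ d, q.1 (m+d) = q'.1 (m+d) := by
    intro d
    induction d with
    | zero => exact e
    | succ d ih =>
      refine (c (m+d)).inj _ _ ?_ ?_
      · have := LPos.len c q (m+d+1)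
        exact le_trans (le_of_eq this) (by omega)
      · exact (q.2 (m+d)).trans (ih.trans (q'.2 (m+d)).symm)
  have down : ∀ d j, j + d = m → q.1 j = q'.1 j := by
    intro d
    induction d with
    | zero => rintro j rfl; exact e
    | succ d ih =>
      intro j hj
      rw [← q.2, ← q'.2, ih (j+1) (by omega)]
  rcases le_total m j with h | h
  · obtain ⟨d, rfl⟩ := Nat.exists_eq_add_of_le h
    exact up d
  · obtain ⟨d, rfl⟩ := Nat.exists_eq_add_of_le h
    exact down d j rfl

theorem LPos.surj (m : ℕ) (t : (T m).Pos) (ht : (T m).len t ≤ k + m) :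
    ∃ q : LPos c, q.1 m = t := by
  obtain ⟨s, h1, h2⟩ := coh_exists m T (fun j => (c j).h) _
    (fun j hj s hs => (c j).surj s (by omega)) t rfl
  exact ⟨⟨s, h1⟩, h2⟩

def lpar (q : LPos c) : LPos c := ⟨fun j => (T j).par (q.1 j), fun j => by
  rw [← (c j).h.par, q.2]⟩

theorem lnext (q : LPos c) : ∃ q' : LPos c, lpar c q' = q ∧
    (T 0).len (q'.1 0) = (T 0).len (q.1 0) + 1 := by
  let m := (T 0).len (q.1 0) + 1
  obtain ⟨q', h⟩ := LPos.surj c m ((T m).next (q.1 m)) (by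
    rw [(T m).len_next, LPos.len c q]; omega)
  have hl : (T 0).len (q'.1 0) = (T 0).len (q.1 0) + 1 := by
    rw [← LPos.len c q' m, h, (T m).len_next, LPos.len c q]
  refine ⟨q', ?_, hl⟩
  refine LPos.inj c _ _ m ?_ ?_
  · show (T 0).len ((T 0).par (q'.1 0)) ≤ _
    rw [(T 0).len_par]; omega
  · show (T m).par (q'.1 m) = _
    rw [h, (T m).par_next]

noncomputable def LT : GT where
  Pos := LPos c
  len := fun q => (T 0).len (q.1 0)
  par := lpar c
  len_par := fun _ => (T 0).len_par _
  next := fun q => (lnext c q).choose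
  par_next := fun q => (lnext c q).choose_spec.1
  len_next := fun q => (lnext c q).choose_spec.2

def Lpr (m : ℕ) : Hm (LT c) (T m) where
  f := fun q => q.1 m
  len := fun q => LPos.len c q m
  par := fun _ => rfl

noncomputable def tr (τ : Strat (LT c)) (M : ℕ) : Strat (T M) where
  f := fun s => if h : (T M).len s ≤ k + M then (τ.f (LPos.surj c M s h).choose).1 M
    else (T M).next s
  ch := fun s => by
    split_ifs with h
    · have hq := (LPos.surj c M s h).choose_spec
      have hc := τ.ch (LPos.surj c M s h).choose
      refine ⟨?_, ?_⟩
      · have := (Lpr c M).par (τ.f (LPos.surj c M s h).choose)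
        rw [hc.1] at this
        exact this.trans hq
      · have h1 := (Lpr c M).len (τ.f (LPos.surj c M s h).choose)
        have h2 := (Lpr c M).len (LPos.surj c M s h).choose
        rw [hc.2, ← h2] at h1
        refine h1.trans ?_
        show (T M).len ((LPos.surj c M s h).choose.1 M) + 1 = _
        rw [hq]
    · exact ⟨(T M).par_next s, (T M).len_next s⟩

theorem tr_spec (τ : Strat (LT c)) (M : ℕ) (q : LPos c) (hq : (T M).len (q.1 M) ≤ k + M) :
    (tr c τ M).f (q.1 M) = (τ.f q).1 M := by
  have e : (tr c τ M).f (q.1 M) = (τ.f (LPos.surj c M (q.1 M) hq).choose).1 M := dif_pos hq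
  rw [e]
  have := (LPos.surj c M (q.1 M) hq).choose_spec
  rw [LPos.inj c _ q M ?_ this]
  rw [← LPos.len c _ M, this]; exact hq

theorem tr_loc (τ τ' : Strat (LT c)) (n M : ℕ) (h : Agr n τ τ') : Agr n (tr c τ M) (tr c τ' M) := by
  intro s hs
  by_cases hl : (T M).len s ≤ k + M
  · obtain ⟨q, rfl⟩ := LPos.surj c M s hl
    rw [tr_spec c _ _ _ hl, tr_spec c _ _ _ hl]
    have := h q (by
      show (T 0).len (q.1 0) < n
      rw [← LPos.len c q M]; exact hs)
    exact congrArg (fun z : LPos c => z.1 M) this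
  · have e1 : (tr c τ M).f s = (T M).next s := dif_neg hl
    have e2 : (tr c τ' M).f s = (T M).next s := dif_neg hl
    rw [e1, e2]

noncomputable def la (p : Bool) (τ : Strat (LT c)) : ℕ → ∀ m, Strat (T m)
  | 0 => fun m => tr c τ m
  | d+1 => fun m => (c m).φ p (la p τ d (m+1))

theorem la_loc (p : Bool) (τ τ' : Strat (LT c)) (n d : ℕ) (h : Agr n τ τ') :
    ∀ m, Agr n (la c p τ d m) (la c p τ' d m) := by
  induction d with
  | zero => intro m; exact tr_loc c τ τ' n m h
  | succ d ih => intro m; exact (c m).loc _ _ _ _ (ih (m+1))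

theorem la_step (p : Bool) (τ : Strat (LT c)) (d : ℕ) :
    ∀ m, Agr (k + m + d) (la c p τ (d+1) m) (la c p τ d m) := by
  induction d with
  | zero =>
    intro m s hs
    obtain ⟨q, rfl⟩ := LPos.surj c m s (by omega)
    show ((c m).φ p (tr c τ (m+1))).f _ = (tr c τ m).f _
    have hl1 := LPos.len c q m
    have hl2 := LPos.len c q (m+1)
    rw [tr_spec c τ m q (by omega)]
    conv_lhs => rw [← q.2 m]
    rw [(c m).idk _ _ _ (by omega), tr_spec c τ (m+1) q (by omega), (τ.f q).2 m]
  | succ d ih =>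
    intro m
    have := (c m).loc p _ _ _ (ih (m+1))
    rw [show k + m + (d+1) = k + (m+1) + d by omega]
    exact this

theorem la_mono (p : Bool) (τ : Strat (LT c)) (d e m : ℕ) :
    Agr (k + m + d) (la c p τ (d+e) m) (la c p τ d m) := by
  induction e with
  | zero => intro s _; rfl
  | succ e ih =>
    intro s hs
    rw [← ih s hs]
    exact la_step c p τ (d+e) m s (by omega)

noncomputable def ls (p : Bool) (τ : Strat (LT c)) (m : ℕ) : Strat (T m) where
  f := fun s => (la c p τ ((T m).len s + 1) m).f s
  ch := fun s => (la c p τ ((T m).len s + 1) m).ch s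

theorem ls_eq (p : Bool) (τ : Strat (LT c)) (m d : ℕ) (s : (T m).Pos) (hs : (T m).len s < d) :
    (ls c p τ m).f s = (la c p τ d m).f s := by
  obtain ⟨e, rfl⟩ := Nat.exists_eq_add_of_le (show (T m).len s + 1 ≤ d from hs)
  exact (la_mono c p τ _ e m s (by omega)).symm

theorem ls_step (p : Bool) (τ : Strat (LT c)) (m : ℕ) (s : (T m).Pos) :
    (ls c p τ m).f s = ((c m).φ p (ls c p τ (m+1))).f s := by
  rw [ls_eq c p τ m ((T m).len s + 2) s (by omega)]
  show ((c m).φ p (la c p τ ((T m).len s + 1) (m+1))).f s = _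
  refine (c m).loc p ((T m).len s + 1) _ _ ?_ s (by omega)
  intro s' hs'
  exact (ls_eq c p τ (m+1) _ s' hs').symm

theorem ls_low (p : Bool) (τ : Strat (LT c)) (m : ℕ) (s : (T m).Pos) (hs : (T m).len s < k + m) :
    (ls c p τ m).f s = (tr c τ m).f s := by
  have := la_mono c p τ 0 ((T m).len s + 1) m s (by omega)
  rw [Nat.zero_add] at this
  exact this

theorem ls_lift (p : Bool) (τ : Strat (LT c)) (x : Play (T 0)) (hx : Cons p (ls c p τ 0) x) :
    ∃ y : Play (LT c), Cons p τ y ∧ (Lpr c 0).play y = x := by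
  have st : ∀ m (x : {x : Play (T m) // Cons p (ls c p τ m) x}),
      ∃ y : {x : Play (T (m+1)) // Cons p (ls c p τ (m+1)) x}, (c m).h.play y.1 = x.1 := by
    rintro m ⟨x, hx⟩
    obtain ⟨y, h1, h2⟩ := (c m).lift p (ls c p τ (m+1)) x
      (fun n hn => by rw [← ls_step]; exact hx n hn)
    exact ⟨⟨y, h1⟩, h2⟩
  choose g hg using st
  let X : ∀ m, {x : Play (T m) // Cons p (ls c p τ m) x} := fun m =>
    Nat.rec (motive := fun m => {x : Play (T m) // Cons p (ls c p τ m) x}) ⟨x, hx⟩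
      (fun m s => g m s) m
  have hX : ∀ m n, (c m).h.f ((X (m+1)).1.x n) = (X m).1.x n := by
    intro m n
    exact congrArg (fun z : Play (T m) => z.x n) (hg m (X m))
  let y : Play (LT c) := 
    { x := fun n => ⟨fun m => (X m).1.x n, fun m => hX m n⟩
      len := fun n => x.len n
      par := fun n => Subtype.ext (funext fun m => (X m).1.par n) }
  refine ⟨y, ?_, Play.ext' fun n => rfl⟩
  intro n hn
  refine LPos.inj c _ _ (n+1) ?_ ?_
  · show (T 0).len (x.x (n+1)) ≤ _
    rw [x.len]; omega
  · have h1 := (X (n+1)).2 n hn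
    have hl : (T (n+1)).len ((X (n+1)).1.x n) = n := (X (n+1)).1.len n
    rw [ls_low _ _ _ _ _ (by omega)] at h1
    exact h1.trans (tr_spec c τ (n+1) (y.x n) (show (T (n+1)).len ((X (n+1)).1.x n) ≤ _ by omega))

noncomputable def LCov : Cov k (LT c) (T 0) where
  h := Lpr c 0
  φ := fun p τ => ls c p τ 0
  loc := fun p n τ τ' h s hs => la_loc c p τ τ' n _ h 0 s hs
  idk := fun p τ q hq => by
    show (ls c p τ 0).f (q.1 0) = _
    rw [ls_low c p τ 0 _ (show (T 0).len (q.1 0) < _ from hq)]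
    exact tr_spec c τ 0 q (le_of_lt hq)
  inj := fun q q' hq e => LPos.inj c q q' 0 hq e
  surj := fun s hs => LPos.surj c 0 s hs
  lift := fun p τ x hx => ls_lift c p τ x hx

end limit

def OpenUnravel : Prop := ∀ (T : GT) (A : Set (Play T)), IsOp A → ∀ k, ∃ (T' : GT) (c : Cov k T' T),
  Clop (c.h.play ⁻¹' A)

theorem UU_open (H : OpenUnravel) {T : GT} {A : Set (Play T)} (hA : IsOp A) : UU A := by
  intro T' h k
  obtain ⟨T'', c, hc⟩ := H T' _ (hA.pre h) k
  exact ⟨T'', c, hc⟩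

theorem UU_compl {T : GT} {A : Set (Play T)} (hA : UU A) : UU Aᶜ := by
  intro T' h k
  obtain ⟨T'', c, hc⟩ := hA T' h k
  refine ⟨T'', c, hc.2, ?_⟩
  have := hc.1
  rwa [Set.preimage_compl, compl_compl]

theorem UU_iUnion (H : OpenUnravel) {T : GT} {A : ℕ → Set (Play T)} (hA : ∀ n, UU (A n)) :
    UU (⋃ n, A n) := by
  intro T' h k
  choose g c hc using hA
  let X : ℕ → (Σ T' : GT, Hm T' T) := fun n => Nat.rec ⟨T', h⟩
    (fun n Y => ⟨g n Y.1 Y.2 (k+n), Y.2.comp (c n Y.1 Y.2 (k+n)).h⟩) n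
  let d : ∀ m, Cov (k+m) (X (m+1)).1 (X m).1 := fun m => c m (X m).1 (X m).2 (k+m)
  have hd : ∀ m, Clop ((X (m+1)).2.play ⁻¹' (A m)) := fun m => hc m (X m).1 (X m).2 (k+m)
  let L := LT (T := fun m => (X m).1) d
  let C : Cov k L T' := LCov (T := fun m => (X m).1) d
  have key : ∀ m (y : Play L), (X m).2.play ((Lpr (T := fun m => (X m).1) d m).play y) =
      h.play (C.h.play y) := by
    intro m
    induction m with
    | zero => intro y; rfl
    | succ m ih =>
      intro y
      rw [← ih y]
      apply Play.ext'
      intro n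
      show (X m).2.f ((d m).h.f ((y.x n).1 (m+1))) = (X m).2.f ((y.x n).1 m)
      rw [(y.x n).2 m]
  have hop : IsOp ((h.comp C.h).play ⁻¹' (⋃ n, A n)) := by
    intro y hy
    obtain ⟨m, hm⟩ := Set.mem_iUnion.1 hy
    have hm' : y ∈ (Lpr (T := fun m => (X m).1) d (m+1)).play ⁻¹' ((X (m+1)).2.play ⁻¹' (A m)) := by
      show (X (m+1)).2.play _ ∈ A m
      exact Eq.mpr (congrArg (fun z => z ∈ A m) (key (m+1) y)) hm
    obtain ⟨n, hn⟩ := ((hd m).1.pre (Lpr (T := fun m => (X m).1) d (m+1))) y hm'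
    refine ⟨n, fun z hz => Set.mem_iUnion.2 ⟨m, ?_⟩⟩
    have := hn z hz
    change (X (m+1)).2.play _ ∈ A m at this
    exact Eq.mp (congrArg (fun z => z ∈ A m) (key (m+1) z)) this
  obtain ⟨T'', e, he⟩ := H L _ hop k
  exact ⟨T'', C.comp e, he⟩

end BD

namespace BD

section anc
variable {T : GT}

def anc (n : ℕ) (s : T.Pos) : T.Pos := T.par^[T.len s - n] s

theorem anc_self (s : T.Pos) : anc (T.len s) s = s := by simp [anc]

theorem anc_par (n : ℕ) (s : T.Pos) (h : n < T.len s) : anc n (T.par s) = anc n s := by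
  unfold anc
  rw [T.len_par, show T.len s - n = (T.len s - 1 - n) + 1 by omega, Function.iterate_succ_apply]

theorem anc_ch {n : ℕ} {t s : T.Pos} (hc : T.Ch t s) (h : n ≤ T.len s) : anc n t = anc n s := by
  rw [← anc_par n t (by rw [hc.2]; omega), hc.1]

theorem len_iter (m : ℕ) (s : T.Pos) : T.len (T.par^[m] s) = T.len s - m := by
  induction m with
  | zero => rfl
  | succ m ih => rw [Function.iterate_succ_apply', T.len_par, ih]; omega

theorem len_anc {n : ℕ} {s : T.Pos} (h : n ≤ T.len s) : T.len (anc n s) = n := by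
  unfold anc; rw [len_iter]; omega

theorem anc_anc {n m : ℕ} {s : T.Pos} (h : n ≤ m) (hm : m ≤ T.len s) :
    anc n (anc m s) = anc n s := by
  have : T.len (anc m s) = m := len_anc hm
  unfold anc at this ⊢
  rw [this, ← Function.iterate_add_apply]
  congr 1
  omega

theorem par_anc {n : ℕ} {s : T.Pos} (h : n + 1 ≤ T.len s) : T.par (anc (n+1) s) = anc n s := by
  unfold anc
  rw [← Function.iterate_succ_apply' T.par]
  congr 1
  omega

theorem anc_play (x : Play T) {n m : ℕ} (h : n ≤ m) : anc n (x.x m) = x.x n := by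
  induction m, h using Nat.le_induction with
  | base => have := anc_self (x.x n); rwa [x.len] at this
  | succ m hm ih => rw [← anc_par _ _ (by rw [x.len]; omega), x.par, ih]

theorem play_ch (x : Play T) (n : ℕ) : T.Ch (x.x (n+1)) (x.x n) :=
  ⟨x.par n, by rw [x.len, x.len]⟩

def hered (m : ℕ) (Y : Set T.Pos) : Set T.Pos :=
  {t | m ≤ T.len t ∧ ∀ n, m ≤ n → n ≤ T.len t → anc n t ∈ Y}

theorem hered_mem {m : ℕ} {Y : Set T.Pos} {t : T.Pos} (h : t ∈ hered m Y) : t ∈ Y := by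
  have := h.2 _ h.1 le_rfl
  rwa [anc_self] at this

theorem hered_par {m : ℕ} {Y : Set T.Pos} {t : T.Pos} (h : t ∈ hered m Y) (hm : m < T.len t) :
    T.par t ∈ hered m Y := by
  have hl := T.len_par t
  refine ⟨by omega, fun n h1 h2 => ?_⟩
  rw [anc_par _ _ (by omega)]
  exact h.2 n h1 (by omega)

theorem hered_ch {m : ℕ} {Y : Set T.Pos} {t s : T.Pos} (hc : T.Ch t s) (hs : s ∈ hered m Y)
    (ht : t ∈ Y) : t ∈ hered m Y := by
  have hl := hc.2
  have hm := hs.1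
  refine ⟨by omega, fun n h1 h2 => ?_⟩
  rcases Nat.lt_or_ge (T.len s) n with h | h
  · have : n = T.len t := by omega
    rw [this, anc_self]; exact ht
  · rw [anc_ch hc h]; exact hs.2 n h1 h

theorem hered_root {m : ℕ} {Y : Set T.Pos} {t : T.Pos} (h : T.len t = m) (ht : t ∈ Y) :
    t ∈ hered m Y := by
  refine ⟨h.ge, fun n h1 h2 => ?_⟩
  have : n = T.len t := by omega
  rw [this, anc_self]; exact ht

theorem hered_play {m : ℕ} {Y : Set T.Pos} (x : Play T) {n j : ℕ} (h : x.x n ∈ hered m Y)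
    (h1 : m ≤ j) (h2 : j ≤ n) : x.x j ∈ hered m Y := by
  refine ⟨by rw [x.len]; exact h1, fun i h3 h4 => ?_⟩
  rw [x.len] at h4
  have := h.2 i h3 (by rw [x.len]; omega)
  rw [anc_play x (by omega)] at this ⊢
  exact this

end anc

section unr
variable {T : GT} (C : Set T.Pos) (K : ℕ)

def BU (u : T.Pos) : Set T.Pos := {t | K + 2 ≤ T.len t ∧
  ((T.len t ≤ T.len u ∧ t = anc (T.len t) u) ∨ (T.len u ≤ T.len t ∧ anc (T.len u) t = u))}

structure QI (A : Set T.Pos) : Prop where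
  low : ∀ t ∈ A, K + 1 ≤ T.len t
  par : ∀ t ∈ A, K + 1 < T.len t → T.par t ∈ A
  ex : ∀ t ∈ A, tn false (T.len t) → ∃ t', T.Ch t' t ∧ t' ∈ A
  all : ∀ t ∈ A, ¬ tn false (T.len t) → ∀ t', T.Ch t' t → t' ∈ A

structure ST (B : Set T.Pos) : Prop where
  low : ∀ t ∈ B, K + 2 ≤ T.len t
  par : ∀ t ∈ B, K + 2 < T.len t → T.par t ∈ B
  ex : ∀ t ∈ B, ∃ t', T.Ch t' t ∧ t' ∈ B

def O1 (A B : Set T.Pos) : Prop := ∃ u ∈ A, u ∉ C ∧ K + 2 ≤ T.len u ∧ B = BU K u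

def O2 (A B : Set T.Pos) : Prop := B ⊆ A ∧ B ⊆ C ∧ ST K B ∧
  ∀ t ∈ B, tn false (T.len t) → ∀ t', T.Ch t' t → t' ∈ A → t' ∈ B

def VB (A B : Set T.Pos) : Prop := O1 C K A B ∨ O2 C K A B

variable {C K}

theorem QI.anc {A : Set T.Pos} (h : QI K A) {u : T.Pos} (hu : u ∈ A) (n : ℕ) (h1 : K + 1 ≤ n)
    (h2 : n ≤ T.len u) : anc n u ∈ A := by
  obtain ⟨d, hd⟩ := Nat.exists_eq_add_of_le h2
  induction d generalizing n with
  | zero => rw [show n = T.len u by omega, anc_self]; exact hu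
  | succ d ih =>
    have := ih (n+1) (by omega) (by omega) (by omega)
    rw [← par_anc (by omega)]
    exact h.par _ this (by rw [len_anc (by omega)]; omega)

theorem BU_low {u t : T.Pos} (ht : t ∈ BU K u) (h : T.len t ≤ T.len u) : t = anc (T.len t) u := by
  rcases ht.2 with h1 | h1
  · exact h1.2
  · have e : T.len t = T.len u := by omega
    have := h1.2
    rw [← e, anc_self] at this
    rw [this, anc_self]

theorem BU_self {u : T.Pos} (h : K + 2 ≤ T.len u) : u ∈ BU K u :=
  ⟨h, Or.inl ⟨le_rfl, (anc_self u).symm⟩⟩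

theorem BU_anc {u : T.Pos} {n : ℕ} (h : K + 2 ≤ n) (h2 : n ≤ T.len u) : anc n u ∈ BU K u := by
  refine ⟨by rw [len_anc h2]; exact h, Or.inl ?_⟩
  rw [len_anc h2]
  exact ⟨h2, rfl⟩

theorem BU_ST {u : T.Pos} (hu : K + 2 ≤ T.len u) : ST K (BU K u) where
  low := fun t ht => ht.1
  par := fun t ht hl => by
    rcases Nat.lt_or_ge (T.len u) (T.len t) with h | h
    · refine ⟨by rw [T.len_par]; omega, Or.inr ⟨by rw [T.len_par]; omega, ?_⟩⟩
      rw [anc_par _ _ h]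
      rcases ht.2 with h1 | h1
      · omega
      · exact h1.2
    · have e := BU_low ht h
      have : T.par t = anc (T.len t - 1) u := by
        rw [e, show T.len (anc (T.len t) u) = T.len t - 1 + 1 by rw [len_anc h]; omega]
        have h3 : T.len t = T.len t - 1 + 1 := by omega
        conv_lhs => rw [h3]
        rw [par_anc (by omega)]
        simp
      rw [this]
      exact BU_anc (by omega) (by omega)
  ex := fun t ht => by
    rcases Nat.lt_or_ge (T.len t) (T.len u) with h | h
    · refine ⟨anc (T.len t + 1) u, ⟨?_, len_anc h⟩, BU_anc (by have := ht.1; omega) h⟩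
      rw [par_anc h, ← BU_low ht h.le]
    · have hc : T.Ch (T.next t) t := ⟨T.par_next t, T.len_next t⟩
      have := ht.1
      have hl := T.len_next t
      refine ⟨T.next t, hc, ⟨by omega, Or.inr ⟨by omega, ?_⟩⟩⟩
      rw [anc_ch hc h]
      rcases ht.2 with h1 | h1
      · have := BU_low ht h1.1
        have e : T.len t = T.len u := by omega
        rw [e, anc_self] at this
        rw [this, anc_self]
      · exact h1.2

theorem VB.st {A B : Set T.Pos} (h : VB C K A B) : ST K B := by
  rcases h with ⟨u, -, -, hu, rfl⟩ | h
  · exact BU_ST hu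
  · exact h.2.2.1

theorem VB.parA {A B : Set T.Pos} (h : VB C K A B) (hA : QI K A) {t : T.Pos} (ht : t ∈ B)
    (hl : T.len t = K + 2) : T.par t ∈ A := by
  rcases h with ⟨u, hu, -, hul, rfl⟩ | h
  · have := BU_low ht (by omega)
    rw [this, hl, par_anc hul]
    exact hA.anc hu _ le_rfl (by omega)
  · exact hA.par _ (h.1 ht) (by omega)

variable (C K)
structure V (s : T.Pos) (A B : Set T.Pos) : Prop where
  v0 : T.len s ≤ K → A = ∅ ∧ B = ∅
  v1 : T.len s = K + 1 → QI K A ∧ s ∈ A ∧ B = ∅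
  v2 : K + 2 ≤ T.len s → QI K A ∧ VB C K A B ∧ s ∈ B

structure UP where
  s : T.Pos
  A : Set T.Pos
  B : Set T.Pos
  v : V C K s A B

variable {C K}
theorem UP.ext' {q q' : UP C K} (h1 : q.s = q'.s) (h2 : q.A = q'.A) (h3 : q.B = q'.B) : q = q' := by
  cases q; cases q'
  simp only at h1 h2 h3
  subst h1 h2 h3
  rfl

theorem V.mk0 {s : T.Pos} (h : T.len s ≤ K) : V C K s ∅ ∅ :=
  ⟨fun _ => ⟨rfl, rfl⟩, fun _ => by omega, fun _ => by omega⟩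

theorem V.mk1 {s : T.Pos} {A : Set T.Pos} (h : T.len s = K + 1) (hA : QI K A) (hs : s ∈ A) :
    V C K s A ∅ :=
  ⟨fun _ => by omega, fun _ => ⟨hA, hs, rfl⟩, fun _ => by omega⟩

theorem V.mk2 {s : T.Pos} {A B : Set T.Pos} (hA : QI K A) (hB : VB C K A B)
    (hs : s ∈ B) : V C K s A B := by
  have := hB.st.low s hs
  exact ⟨fun _ => by omega, fun _ => by omega, fun _ => ⟨hA, hB, hs⟩⟩

noncomputable def upar (q : UP C K) : UP C K where
  s := T.par q.s
  A := if T.len q.s ≤ K + 1 then ∅ else q.A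
  B := if T.len q.s ≤ K + 2 then ∅ else q.B
  v := by
    have hl := T.len_par q.s
    by_cases h1 : T.len q.s ≤ K + 1
    · rw [if_pos h1, if_pos (by omega)]
      exact V.mk0 (by omega)
    · rw [if_neg h1]
      obtain ⟨ha, hb, hs⟩ := q.v.v2 (by omega)
      by_cases h2 : T.len q.s ≤ K + 2
      · rw [if_pos h2]
        exact V.mk1 (by omega) ha (hb.parA ha hs (by omega))
      · rw [if_neg h2]
        exact V.mk2 ha hb (hb.st.par _ hs (by omega))

theorem QI_all : QI K {t : T.Pos | K + 1 ≤ T.len t} where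
  low := fun _ h => h
  par := fun t _ h2 => by
    have := T.len_par t
    show K + 1 ≤ _
    omega
  ex := fun t h _ => ⟨T.next t, ⟨T.par_next t, T.len_next t⟩, by
    have := T.len_next t
    change K + 1 ≤ _ at h
    show K + 1 ≤ _
    omega⟩
  all := fun t h _ t' hc => by
    have := hc.2
    change K + 1 ≤ _ at h
    show K + 1 ≤ _
    omega

theorem VB_ex (hK : K % 2 = 0) {A : Set T.Pos} (hA : QI K A) {s : T.Pos} (hs : s ∈ A)
    (hl : T.len s = K + 1) :
    ∃ B t, VB C K A B ∧ T.Ch t s ∧ t ∈ B := by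
  by_cases hu : ∃ u ∈ A, u ∉ C ∧ K + 2 ≤ T.len u ∧ anc (K+1) u = s
  · obtain ⟨u, h1, h2, h3, h4⟩ := hu
    refine ⟨BU K u, anc (K+2) u, Or.inl ⟨u, h1, h2, h3, rfl⟩, ⟨?_, ?_⟩, BU_anc le_rfl h3⟩
    · rw [par_anc h3, h4]
    · rw [len_anc h3, hl]
  · push Not at hu
    have hlow : ∀ t ∈ A, K + 1 ≤ T.len t := hA.low
    have hc : T.Ch (T.next s) s := ⟨T.par_next s, T.len_next s⟩
    have hsub : ∀ t, K + 2 ≤ T.len t → ∀ t', T.Ch t' t → anc (K+1) t = s → anc (K+1) t' = s := by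
      intro t ht t' hc h
      rw [anc_ch hc (by omega), h]
    refine ⟨{t | t ∈ A ∧ K + 2 ≤ T.len t ∧ anc (K+1) t = s}, T.next s, Or.inr ⟨fun t ht => ht.1, ?_, ?_, ?_⟩,
      hc, ?_⟩
    · rintro t ⟨h1, h2, h3⟩
      by_contra hn
      exact hu t h1 hn h2 h3
    · refine ⟨fun t ht => ht.2.1, ?_, ?_⟩
      · rintro t ⟨h1, h2, h3⟩ h4
        refine ⟨hA.par t h1 (by omega), by rw [T.len_par]; omega, ?_⟩
        rw [anc_par _ _ (by omega), h3]
      · rintro t ⟨h1, h2, h3⟩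
        by_cases ht : tn false (T.len t)
        · obtain ⟨t', hc', h'⟩ := hA.ex t h1 ht
          exact ⟨t', hc', h', by rw [hc'.2]; omega, hsub t h2 t' hc' h3⟩
        · have hc' : T.Ch (T.next t) t := ⟨T.par_next t, T.len_next t⟩
          exact ⟨T.next t, hc', hA.all t h1 ht _ hc', by rw [hc'.2]; omega, hsub t h2 _ hc' h3⟩
    · rintro t ⟨h1, h2, h3⟩ _ t' hc' h'
      exact ⟨h', by rw [hc'.2]; omega, hsub t h2 t' hc' h3⟩
    · refine ⟨hA.all s hs ?_ _ hc, by rw [hc.2]; omega, ?_⟩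
      · rw [tn_false, hl]; omega
      · rw [anc_ch hc (by omega), ← hl, anc_self]

theorem unext (hK : K % 2 = 0) (q : UP C K) : ∃ q' : UP C K, upar q' = q ∧ T.len q'.s = T.len q.s + 1 := by
  have hc : T.Ch (T.next q.s) q.s := ⟨T.par_next _, T.len_next _⟩
  rcases Nat.lt_trichotomy (T.len q.s) K with h | h | h
  · refine ⟨⟨T.next q.s, ∅, ∅, V.mk0 (by rw [hc.2]; omega)⟩, UP.ext' hc.1 ?_ ?_, hc.2⟩
    · rw [(q.v.v0 (by omega)).1]; simp [upar]
    · rw [(q.v.v0 (by omega)).2]; simp [upar]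
  · refine ⟨⟨T.next q.s, _, ∅, V.mk1 (by rw [hc.2]; omega) QI_all (by show K + 1 ≤ _; rw [hc.2]; omega)⟩,
      UP.ext' hc.1 ?_ ?_, hc.2⟩
    · rw [(q.v.v0 (by omega)).1]; exact if_pos (by show T.len (T.next q.s) ≤ _; rw [hc.2]; omega)
    · rw [(q.v.v0 (by omega)).2]; simp [upar]
  · rcases Nat.lt_or_ge (K+1) (T.len q.s) with h' | h'
    · obtain ⟨ha, hb, hs⟩ := q.v.v2 h'
      obtain ⟨t, hc, ht⟩ := hb.st.ex _ hs
      refine ⟨⟨t, q.A, q.B, V.mk2 ha hb ht⟩, UP.ext' hc.1 ?_ ?_, hc.2⟩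
      · exact if_neg (by show ¬ T.len t ≤ _; rw [hc.2]; omega)
      · exact if_neg (by show ¬ T.len t ≤ _; rw [hc.2]; omega)
    · obtain ⟨ha, hs, hb⟩ := q.v.v1 (by omega)
      obtain ⟨B, t, h1, hc, ht⟩ := VB_ex (C := C) hK ha hs (by omega)
      refine ⟨⟨t, q.A, B, V.mk2 ha h1 ht⟩, UP.ext' hc.1 ?_ ?_, hc.2⟩
      · exact if_neg (by show ¬ T.len t ≤ _; rw [hc.2]; omega)
      · rw [hb]; exact if_pos (by show T.len t ≤ _; rw [hc.2]; omega)

variable (C) in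
noncomputable def UT (hK : K % 2 = 0) : GT where
  Pos := UP C K
  len := fun q => T.len q.s
  par := upar
  len_par := fun _ => T.len_par _
  next := fun q => (unext hK q).choose
  par_next := fun q => (unext hK q).choose_spec.1
  len_next := fun q => (unext hK q).choose_spec.2

variable {hK : K % 2 = 0}

theorem uch_s {q' q : UP C K} (h : (UT C hK).Ch q' q) : T.Ch q'.s q.s := by
  refine ⟨?_, h.2⟩
  have := h.1
  change upar q' = q at this
  rw [← this]; rfl

theorem uch_A {q' q : UP C K} (h : (UT C hK).Ch q' q) (hl : K + 1 ≤ T.len q.s) : q'.A = q.A := by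
  have h1 := h.1
  change upar q' = q at h1
  have h2 := (uch_s h).2
  have : (upar q').A = q'.A := if_neg (by omega)
  rw [← this, h1]

theorem uch_B {q' q : UP C K} (h : (UT C hK).Ch q' q) (hl : K + 2 ≤ T.len q.s) : q'.B = q.B := by
  have h1 := h.1
  change upar q' = q at h1
  have h2 := (uch_s h).2
  have : (upar q').B = q'.B := if_neg (by omega)
  rw [← this, h1]

noncomputable def ev (σ : Strat (UT C hK)) (s : T.Pos) (A B : Set T.Pos) : T.Pos :=
  if h : V C K s A B then (UP.s (σ.f ⟨s, A, B, h⟩)) else T.next s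

noncomputable def evA (σ : Strat (UT C hK)) (s : T.Pos) : Set T.Pos :=
  if h : V C K s ∅ ∅ then (UP.A (σ.f ⟨s, ∅, ∅, h⟩)) else ∅

noncomputable def evB (σ : Strat (UT C hK)) (s : T.Pos) (A : Set T.Pos) : Set T.Pos :=
  if h : V C K s A ∅ ∧ T.len s = K + 1 then (UP.B (σ.f ⟨s, A, ∅, h.1⟩)) else ∅

theorem ev_ch (σ : Strat (UT C hK)) (s : T.Pos) (A B : Set T.Pos) : T.Ch (ev σ s A B) s := by
  unfold ev
  split_ifs with h
  · exact uch_s (σ.ch ⟨s, A, B, h⟩)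
  · exact ⟨T.par_next s, T.len_next s⟩

theorem ev_loc {σ τ : Strat (UT C hK)} {n : ℕ} (h : Agr n σ τ) {s : T.Pos} (hs : T.len s < n)
    (A B : Set T.Pos) : ev σ s A B = ev τ s A B := by
  unfold ev
  split_ifs with hv
  · exact congrArg UP.s (h ⟨s, A, B, hv⟩ hs)
  · rfl

theorem evA_loc {σ τ : Strat (UT C hK)} {n : ℕ} (h : Agr n σ τ) {s : T.Pos} (hs : T.len s < n) :
    evA σ s = evA τ s := by
  unfold evA
  split_ifs with hv
  · exact congrArg UP.A (h ⟨s, ∅, ∅, hv⟩ hs)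
  · rfl

theorem evB_loc {σ τ : Strat (UT C hK)} {n : ℕ} (h : Agr n σ τ) (hn : K + 1 < n) :
    evB σ = evB τ := by
  funext s A
  unfold evB
  split_ifs with hv
  · exact congrArg UP.B (h ⟨s, A, ∅, hv.1⟩ (show T.len s < n by omega))
  · rfl

theorem ev0 (σ : Strat (UT C hK)) (s : T.Pos) (hl : T.len s = K) :
    QI K (evA σ s) ∧ ev σ s ∅ ∅ ∈ evA σ s := by
  have h : V C K s ∅ ∅ := V.mk0 hl.le
  unfold ev evA
  rw [dif_pos h, dif_pos h]
  have h1 : T.len (UP.s (σ.f ⟨s, ∅, ∅, h⟩)) = T.len s + 1 := (uch_s (σ.ch ⟨s, ∅, ∅, h⟩)).2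
  have := (UP.v (σ.f ⟨s, ∅, ∅, h⟩)).v1 (by omega)
  exact ⟨this.1, this.2.1⟩

theorem ev1 (σ : Strat (UT C hK)) (s : T.Pos) (A : Set T.Pos) (h : V C K s A ∅) (hl : T.len s = K + 1) :
    VB C K A (evB σ s A) ∧ ev σ s A ∅ ∈ evB σ s A := by
  unfold ev evB
  rw [dif_pos h, dif_pos ⟨h, hl⟩]
  have hc := σ.ch ⟨s, A, ∅, h⟩
  have h1 : T.len (UP.s (σ.f ⟨s, A, ∅, h⟩)) = T.len s + 1 := (uch_s hc).2
  have h2 : (UP.A (σ.f ⟨s, A, ∅, h⟩)) = A := uch_A hc hl.ge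
  have := (UP.v (σ.f ⟨s, A, ∅, h⟩)).v2 (by omega)
  rw [h2] at this
  exact ⟨this.2.1, this.2.2⟩

theorem ev2 (σ : Strat (UT C hK)) (s : T.Pos) (A B : Set T.Pos) (h : V C K s A B) (hl : K + 2 ≤ T.len s) :
    ev σ s A B ∈ B := by
  unfold ev
  rw [dif_pos h]
  have hc := σ.ch ⟨s, A, B, h⟩
  have h1 : T.len (UP.s (σ.f ⟨s, A, B, h⟩)) = T.len s + 1 := (uch_s hc).2
  have h2 : (UP.B (σ.f ⟨s, A, B, h⟩)) = B := uch_B hc hl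
  have := (UP.v (σ.f ⟨s, A, B, h⟩)).v2 (by omega)
  rw [h2] at this
  exact this.2.2

theorem ev_forced (σ : Strat (UT C hK)) (s u : T.Pos) (A : Set T.Pos) (h : V C K s A (BU K u))
    (hl : K + 2 ≤ T.len s) (hu : T.len s < T.len u) : ev σ s A (BU K u) = anc (T.len s + 1) u := by
  have h1 := ev2 σ s A _ h hl
  have h2 := (ev_ch σ s A (BU K u)).2
  have := BU_low h1 (by omega)
  rw [this, h2]

variable (C) (hK) in
def Upr : Hm (UT C hK) T where
  f := fun q => q.s
  len := fun _ => rfl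
  par := fun _ => rfl

theorem lift_play (p : Bool) (σ : Strat (UT C hK)) (x : Play T) (A B : Set T.Pos) (hA : QI K A)
    (hB : VB C K A B) (h1 : x.x (K+1) ∈ A) (h2 : ∀ n, K + 2 ≤ n → x.x n ∈ B)
    (a : ∀ n, n ≤ K → tn p n → x.x (n+1) = ev σ (x.x n) ∅ ∅)
    (b : tn p K → A = evA σ (x.x K))
    (c : tn p (K+1) → x.x (K+2) = ev σ (x.x (K+1)) A ∅ ∧ B = evB σ (x.x (K+1)) A)
    (d : ∀ n, K + 2 ≤ n → tn p n → x.x (n+1) = ev σ (x.x n) A B) :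
    ∃ y : Play (UT C hK), Cons p σ y ∧ (Upr C hK).play y = x := by
  have hv0 : ∀ n, n ≤ K → V C K (x.x n) ∅ ∅ := fun n hn => V.mk0 (by rw [x.len]; exact hn)
  have hv1 : V C K (x.x (K+1)) A ∅ := V.mk1 (x.len _) hA h1
  have hv2 : ∀ n, K + 2 ≤ n → V C K (x.x n) A B := fun n hn => V.mk2 hA hB (h2 n hn)
  have hv : ∀ n, V C K (x.x n) (if n ≤ K then ∅ else A) (if n ≤ K + 1 then ∅ else B) := by
    intro n
    rcases Nat.lt_trichotomy n (K+1) with h | h | h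
    · rw [if_pos (by omega), if_pos (by omega)]; exact hv0 n (by omega)
    · subst h; rw [if_neg (by omega), if_pos (by omega)]; exact hv1
    · rw [if_neg (by omega), if_neg (by omega)]; exact hv2 n h
  let y : Play (UT C hK) :=
    { x := fun n => (⟨x.x n, _, _, hv n⟩ : UP C K)
      len := fun n => x.len n
      par := fun n => by
        refine UP.ext' (x.par n) ?_ ?_
        · show (if T.len (x.x (n+1)) ≤ K + 1 then ∅ else (if n + 1 ≤ K then ∅ else A)) = if n ≤ K then ∅ else A
          rw [x.len]
          split_ifs <;> first | rfl | omega
        · show (if T.len (x.x (n+1)) ≤ K + 2 then ∅ else (if n + 1 ≤ K + 1 then ∅ else B)) = if n ≤ K + 1 then ∅ else B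
          rw [x.len]
          split_ifs <;> first | rfl | omega }
  refine ⟨y, ?_, Play.ext' fun n => rfl⟩
  intro n hn
  have hc : (UT C hK).Ch (σ.f (y.x n)) (y.x n) := σ.ch _
  have e0 : (UP.s (σ.f (y.x n))) = ev σ (x.x n) (if n ≤ K then ∅ else A) (if n ≤ K + 1 then ∅ else B) :=
    by unfold ev; rw [dif_pos (hv n)]
  have hl : T.len (x.x n) = n := x.len n
  refine UP.ext' ?_ ?_ ?_
  · rw [e0]
    show x.x (n+1) = _
    rcases Nat.lt_trichotomy n (K+1) with h | h | h
    · rw [if_pos (by omega), if_pos (by omega)]; exact a n (by omega) hn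
    · subst h; rw [if_neg (by omega), if_pos (by omega)]; exact (c hn).1
    · rw [if_neg (by omega), if_neg (by omega)]; exact d n h hn
  · show (if n + 1 ≤ K then ∅ else A) = _
    rcases Nat.lt_trichotomy n K with h | h | h
    · have h3 := (uch_s hc).2
      change _ = T.len (x.x n) + 1 at h3
      rw [if_pos (by omega)]
      exact ((UP.v (σ.f (y.x n))).v0 (by omega)).1.symm
    · subst h
      rw [if_neg (by omega), b hn]
      unfold evA
      rw [dif_pos (hv0 n le_rfl)]
      exact congrArg (fun q => UP.A (σ.f q)) (UP.ext' rfl (if_pos le_rfl).symm (if_pos (by omega)).symm)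
    · rw [if_neg (by omega), uch_A hc (show K + 1 ≤ T.len (x.x n) by omega)]
      exact (if_neg (by omega)).symm
  · show (if n + 1 ≤ K + 1 then ∅ else B) = _
    rcases Nat.lt_trichotomy n (K+1) with h | h | h
    · have h3 := (uch_s hc).2
      change _ = T.len (x.x n) + 1 at h3
      rw [if_pos (by omega)]
      rcases Nat.lt_or_ge n K with h' | h'
      · exact ((UP.v (σ.f (y.x n))).v0 (by omega)).2.symm
      · exact ((UP.v (σ.f (y.x n))).v1 (by omega)).2.2.symm
    · subst h
      rw [if_neg (by omega), (c hn).2]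
      unfold evB
      rw [dif_pos ⟨hv1, x.len _⟩]
      exact congrArg (fun q => UP.B (σ.f q)) (UP.ext' rfl (if_neg (by omega)).symm (if_pos (by omega)).symm)
    · rw [if_neg (by omega), uch_B hc (show K + 2 ≤ T.len (x.x n) by omega)]
      exact (if_neg (by omega)).symm

end unr
end BD

namespace BD

section
variable {T : GT} (S U : Set T.Pos) (p : Bool)
noncomputable def RW : Set T.Pos := (reach T S U p).choose
noncomputable def Rr : Strat T := (reach T S U p).choose_spec.choose

theorem R_sub : RW S U p ⊆ S := (reach T S U p).choose_spec.choose_spec.1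
theorem R_U : ∀ s ∈ S, s ∈ U → s ∈ RW S U p := (reach T S U p).choose_spec.choose_spec.2.1
theorem R_mine : ∀ s ∈ RW S U p, s ∉ U → tn p (T.len s) → (Rr S U p).f s ∈ RW S U p :=
  (reach T S U p).choose_spec.choose_spec.2.2.1
theorem R_opp : ∀ s ∈ RW S U p, s ∉ U → ¬ tn p (T.len s) → ∀ t, T.Ch t s → t ∈ S → t ∈ RW S U p :=
  (reach T S U p).choose_spec.choose_spec.2.2.2.1
theorem R_nmine : ∀ s ∈ S, s ∉ RW S U p → tn p (T.len s) → ∀ t, T.Ch t s → t ∉ RW S U p :=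
  (reach T S U p).choose_spec.choose_spec.2.2.2.2.1
theorem R_nopp : ∀ s ∈ S, s ∉ RW S U p → ¬ tn p (T.len s) →
    ∃ t, T.Ch t s ∧ t ∈ S ∧ t ∉ RW S U p :=
  (reach T S U p).choose_spec.choose_spec.2.2.2.2.2.1
theorem R_fin : ∀ (x : Play T) (N : ℕ), (∀ n, N ≤ n → x.x n ∈ RW S U p) → (∀ n, N ≤ n → x.x n ∉ U) →
      (∀ n, N ≤ n → tn p n → x.x (n+1) = (Rr S U p).f (x.x n)) → False :=
  (reach T S U p).choose_spec.choose_spec.2.2.2.2.2.2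
end

section unr
variable {T : GT} {C : Set T.Pos} {K : ℕ} {hK : K % 2 = 0}

variable (K) in
def FQ (Y : Set T.Pos) (s : T.Pos) : Prop := ∃ n, K + 2 ≤ n ∧ n ≤ T.len s ∧ anc n s ∈ Y

variable (K) in
noncomputable def fu (Y : Set T.Pos) (s : T.Pos) : T.Pos :=
  if h : FQ K Y s then anc (Nat.find h) s else s

theorem fu_play (Y : Set T.Pos) (x : Play T) (n0 m : ℕ) (h0 : K + 2 ≤ n0) (h1 : x.x n0 ∈ Y)
    (h2 : ∀ j, K + 2 ≤ j → j < n0 → x.x j ∉ Y) (hm : n0 ≤ m) : FQ K Y (x.x m) ∧ fu K Y (x.x m) = x.x n0 := by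
  have h : FQ K Y (x.x m) := ⟨n0, h0, by rw [x.len]; exact hm, by rw [anc_play x hm]; exact h1⟩
  refine ⟨h, ?_⟩
  unfold fu
  rw [dif_pos h]
  have : Nat.find h = n0 := by
    refine (Nat.find_eq_iff h).2 ⟨⟨h0, by rw [x.len]; exact hm, by rw [anc_play x hm]; exact h1⟩, ?_⟩
    rintro j hj ⟨h3, h4, h5⟩
    rw [anc_play x (by omega)] at h5
    exact h2 j h3 hj h5
  rw [this, anc_play x hm]

theorem nFQ_play (Y : Set T.Pos) (x : Play T) (h : ∀ j, K + 2 ≤ j → x.x j ∉ Y) (m : ℕ) :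
    ¬ FQ K Y (x.x m) := by
  rintro ⟨n, h1, h2, h3⟩
  rw [x.len] at h2
  rw [anc_play x h2] at h3
  exact h n h1 h3

theorem lift_u (p : Bool) (σ : Strat (UT C hK)) (x : Play T) (A : Set T.Pos) (hA : QI K A) (n0 : ℕ)
    (h0 : K + 2 ≤ n0) (hu : x.x n0 ∈ A) (huC : x.x n0 ∉ C)
    (a : ∀ n, n ≤ K → tn p n → x.x (n+1) = ev σ (x.x n) ∅ ∅)
    (b : tn p K → A = evA σ (x.x K))
    (c : tn p (K+1) → BU K (x.x n0) = evB σ (x.x (K+1)) A)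
    (d : ∀ n, n0 ≤ n → tn p n → x.x (n+1) = ev σ (x.x n) A (BU K (x.x n0))) :
    ∃ y : Play (UT C hK), Cons p σ y ∧ (Upr C hK).play y = x := by
  have hl0 : T.len (x.x n0) = n0 := x.len n0
  have hB : VB C K A (BU K (x.x n0)) := Or.inl ⟨_, hu, huC, by rw [x.len]; exact h0, rfl⟩
  have hx1 : x.x (K+1) ∈ A := by
    rw [← anc_play x (show K + 1 ≤ n0 by omega)]
    exact hA.anc hu _ le_rfl (by omega)
  have hx2 : ∀ n, K + 2 ≤ n → x.x n ∈ BU K (x.x n0) := by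
    intro n hn
    refine ⟨by rw [x.len]; exact hn, ?_⟩
    rw [x.len, x.len]
    rcases le_total n n0 with h | h
    · left; exact ⟨h, by rw [anc_play x h]⟩
    · right; exact ⟨h, by rw [anc_play x h]⟩
  refine lift_play p σ x A _ hA hB hx1 hx2 a b (fun ht => ⟨?_, c ht⟩) ?_
  · have h1 := (ev1 σ (x.x (K+1)) A (V.mk1 (x.len _) hA hx1) (x.len _)).2
    rw [← c ht] at h1
    have h2 := (ev_ch σ (x.x (K+1)) A ∅).2
    rw [x.len] at h2
    rw [BU_low h1 (by omega), h2, anc_play x (by omega)]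
  · intro n hn ht
    rcases Nat.lt_or_ge n n0 with h | h
    · have hl := x.len n
      rw [ev_forced σ _ _ A (V.mk2 hA hB (hx2 n hn)) (by omega) (by omega), hl, anc_play x (by omega)]
    · exact d n h ht

/-! Player I -/
variable (C K) in
noncomputable def DI (A : Set T.Pos) : Set T.Pos := hered (K+2) (A \ RW A Cᶜ false)

noncomputable def gI (σ : Strat (UT C hK)) (A : Set T.Pos) (s : T.Pos) : T.Pos :=
  if FQ K (A \ C) s then ev σ s A (BU K (fu K (A \ C) s))
  else if s ∈ DI C K A then ev σ s A (DI C K A)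
  else (Rr A Cᶜ false).f s

noncomputable def pI (σ : Strat (UT C hK)) : Strat T where
  f := fun s => if T.len s ≤ K then ev σ s ∅ ∅ else gI σ (evA σ (anc K s)) s
  ch := fun s => by
    unfold gI
    split_ifs
    · exact ev_ch _ _ _ _
    · exact ev_ch _ _ _ _
    · exact ev_ch _ _ _ _
    · exact Strat.ch _ _

theorem pI_loc (n : ℕ) (σ τ : Strat (UT C hK)) (h : Agr n σ τ) : Agr n (pI σ) (pI τ) := by
  intro s hs
  have he : ∀ A B, ev σ s A B = ev τ s A B := ev_loc h hs
  show (if T.len s ≤ K then ev σ s ∅ ∅ else gI σ (evA σ (anc K s)) s) =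
    (if T.len s ≤ K then ev τ s ∅ ∅ else gI τ (evA τ (anc K s)) s)
  by_cases hl : T.len s ≤ K
  · rw [if_pos hl, if_pos hl, he]
  · rw [if_neg hl, if_neg hl]
    have : evA σ (anc K s) = evA τ (anc K s) := evA_loc h (by rw [len_anc (by omega)]; omega)
    rw [this]
    unfold gI
    simp only [he]

theorem O2_DI {A : Set T.Pos} (hA : QI K A) : O2 C K A (DI C K A) := by
  have h1 : DI C K A ⊆ A := fun t ht => (hered_mem ht).1
  have h2 : ∀ t ∈ DI C K A, tn false (T.len t) → ∀ t', T.Ch t' t → t' ∈ A → t' ∈ DI C K A := by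
    intro t ht htn t' hc ht'
    exact hered_ch hc ht ⟨ht', R_nmine A Cᶜ false t (h1 ht) (hered_mem ht).2 htn t' hc⟩
  refine ⟨h1, ?_, ⟨fun t ht => ht.1, fun t ht hl => hered_par ht hl, ?_⟩, h2⟩
  · intro t ht
    by_contra hn
    exact (hered_mem ht).2 (R_U A Cᶜ false t (h1 ht) hn)
  · intro t ht
    by_cases htn : tn false (T.len t)
    · obtain ⟨t', hc, h'⟩ := hA.ex t (h1 ht) htn
      exact ⟨t', hc, h2 t ht htn t' hc h'⟩
    · obtain ⟨t', hc, h', h''⟩ := R_nopp A Cᶜ false t (h1 ht) (hered_mem ht).2 htn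
      exact ⟨t', hc, hered_ch hc ht ⟨h', h''⟩⟩

theorem pI_lift (σ : Strat (UT C hK)) (x : Play T) (hx : Cons false (pI σ) x) :
    ∃ y : Play (UT C hK), Cons false σ y ∧ (Upr C hK).play y = x := by
  have hK' := hK
  have hlo : ∀ n, n ≤ K → tn false n → x.x (n+1) = ev σ (x.x n) ∅ ∅ := by
    intro n hn ht
    rw [hx n ht]
    exact if_pos (by rw [x.len]; exact hn)
  obtain ⟨hA, hxA⟩ := ev0 σ (x.x K) (x.len K)
  rw [← hlo K le_rfl ((tn_false K).2 hK)] at hxA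
  have hhi : ∀ n, K < n → tn false n → x.x (n+1) = gI σ (evA σ (x.x K)) (x.x n) := by
    intro n hn ht
    rw [hx n ht]
    show (if T.len (x.x n) ≤ K then _ else gI σ (evA σ (anc K (x.x n))) (x.x n)) = _
    rw [x.len, if_neg (by omega), anc_play x hn.le]
  generalize hAe : evA σ (x.x K) = A at hA hxA hhi
  have hc1 : ¬ tn false (K+1) := by rw [tn_false]; omega
  have ht1 : ¬ tn true K := by rw [tn_true]; omega
  have hxA2 : x.x (K+2) ∈ A := hA.all _ hxA (by rw [x.len]; exact hc1) _ (play_ch x (K+1))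
  by_cases h : ∃ n, K + 2 ≤ n ∧ x.x n ∈ A \ C
  · obtain ⟨h0, hu⟩ := Nat.find_spec h
    have hmin : ∀ j, K + 2 ≤ j → j < Nat.find h → x.x j ∉ A \ C := fun j h1 h2 h3 => Nat.find_min h h2 ⟨h1, h3⟩
    generalize Nat.find h = n0 at h0 hu hmin
    refine lift_u false σ x A hA n0 h0 hu.1 hu.2 hlo (fun _ => hAe.symm) (fun ht => absurd ht hc1) ?_
    intro n hn ht
    obtain ⟨h3, h4⟩ := fu_play (A \ C) x n0 n h0 hu hmin hn
    rw [hhi n (by omega) ht]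
    unfold gI
    rw [if_pos h3, h4]
  · push Not at h
    have hnF := nFQ_play (A \ C) x h
    have hO := O2_DI (C := C) hA
    by_cases hD : ∀ j, K + 2 ≤ j → x.x j ∈ DI C K A
    · refine lift_play false σ x A (DI C K A) hA (Or.inr hO) hxA hD hlo (fun _ => hAe.symm)
        (fun ht => absurd ht hc1) ?_
      intro n hn ht
      rw [hhi n (by omega) ht]
      unfold gI
      rw [if_neg (hnF n), if_pos (hD n hn)]
    · exfalso
      push Not at hD
      have hspec := Nat.find_spec hD
      have hmin : ∀ i, K + 2 ≤ i → i < Nat.find hD → x.x i ∈ DI C K A := by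
        intro i h1 h2
        by_contra h3
        exact Nat.find_min hD h2 ⟨h1, h3⟩
      generalize Nat.find hD = j at hspec hmin
      obtain ⟨hj, hjD⟩ := hspec
      have hjW : x.x j ∈ RW A Cᶜ false := by
        rcases Nat.eq_or_lt_of_le hj with e | e
        · subst e
          by_contra hn
          exact hjD (hered_root (x.len _) ⟨hxA2, hn⟩)
        · obtain ⟨i, rfl⟩ : ∃ i, j = i + 1 := ⟨j - 1, by omega⟩
          have hi := hmin i (by omega) (by omega)
          by_cases ht : tn false i
          · exfalso
            apply hjD
            rw [hhi i (by omega) ht]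
            unfold gI
            rw [if_neg (hnF i), if_pos hi]
            exact ev2 σ _ _ _ (V.mk2 hA (Or.inr hO) hi) (by rw [x.len]; omega)
          · have hA' := hA.all _ (hO.1 hi) (by rw [x.len]; exact ht) _ (play_ch x i)
            by_contra hn
            exact hjD (hered_ch (play_ch x i) hi ⟨hA', hn⟩)
      have hnD : ∀ m, j ≤ m → x.x m ∉ DI C K A := fun m hm h' => hjD (hered_play x h' hj hm)
      have hstep : ∀ n, j ≤ n → tn false n → x.x (n+1) = (Rr A Cᶜ false).f (x.x n) := by
        intro n hn ht
        rw [hhi n (by omega) ht]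
        unfold gI
        rw [if_neg (hnF n), if_neg (hnD n hn)]
      have hW : ∀ n, j ≤ n → x.x n ∈ RW A Cᶜ false ∧ x.x n ∉ Cᶜ := by
        have aux : ∀ n, j ≤ n → x.x n ∈ RW A Cᶜ false → x.x n ∉ Cᶜ := fun n hn hw hc =>
          h n (by omega) ⟨R_sub _ _ _ hw, hc⟩
        intro n hn
        induction n, hn using Nat.le_induction with
        | base => exact ⟨hjW, aux _ le_rfl hjW⟩
        | succ n hn ih =>
          have : x.x (n+1) ∈ RW A Cᶜ false := by
            by_cases ht : tn false n
            · rw [hstep n hn ht]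
              exact R_mine _ _ _ _ ih.1 ih.2 (by rw [x.len]; exact ht)
            · exact R_opp _ _ _ _ ih.1 ih.2 (by rw [x.len]; exact ht) _ (play_ch x n)
                (hA.all _ (R_sub _ _ _ ih.1) (by rw [x.len]; exact ht) _ (play_ch x n))
          exact ⟨this, aux _ (by omega) this⟩
      exact R_fin A Cᶜ false x j (fun n hn => (hW n hn).1) (fun n hn => (hW n hn).2) hstep

/-! Player II -/
variable (C K) in
def PP (G : T.Pos → Set T.Pos → Set T.Pos) (u : T.Pos) (A : Set T.Pos) : Prop :=
  K + 2 ≤ T.len u ∧ QI K A ∧ u ∈ A ∧ u ∉ C ∧ G (anc (K+1) u) A = BU K u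

variable (C K) in
def UG (G : T.Pos → Set T.Pos → Set T.Pos) : Set T.Pos := {u | ∃ A, PP C K G u A}

variable (C K) in
noncomputable def wit (G : T.Pos → Set T.Pos → Set T.Pos) (u : T.Pos) : Set T.Pos :=
  if h : ∃ A, PP C K G u A then h.choose else ∅

theorem wit_spec {G : T.Pos → Set T.Pos → Set T.Pos} {u : T.Pos} (h : u ∈ UG C K G) :
    PP C K G u (wit C K G u) := by
  have h' : ∃ A, PP C K G u A := h
  unfold wit
  rw [dif_pos h']
  exact h'.choose_spec

variable (K) in
def SS : Set T.Pos := {t | K + 1 ≤ T.len t}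

variable (C K) in
noncomputable def EG (G : T.Pos → Set T.Pos → Set T.Pos) : Set T.Pos :=
  hered (K+1) (RW (SS K) (UG C K G) true)ᶜ

noncomputable def gII (σ : Strat (UT C hK)) (G : T.Pos → Set T.Pos → Set T.Pos) (s : T.Pos) : T.Pos :=
  if FQ K (UG C K G) s then
    ev σ s (wit C K G (fu K (UG C K G) s)) (BU K (fu K (UG C K G) s))
  else if s ∈ EG C K G ∧ T.len s = K + 1 then ev σ s (EG C K G) ∅
  else if s ∈ EG C K G ∧ s ∈ G (anc (K+1) s) (EG C K G) then ev σ s (EG C K G) (G (anc (K+1) s) (EG C K G))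
  else (Rr (SS K) (UG C K G) true).f s

noncomputable def pII (σ : Strat (UT C hK)) : Strat T where
  f := fun s => if T.len s ≤ K then ev σ s ∅ ∅ else gII σ (evB σ) s
  ch := fun s => by
    unfold gII
    split_ifs
    · exact ev_ch _ _ _ _
    · exact ev_ch _ _ _ _
    · exact ev_ch _ _ _ _
    · exact ev_ch _ _ _ _
    · exact Strat.ch _ _

theorem pII_loc (n : ℕ) (σ τ : Strat (UT C hK)) (h : Agr n σ τ) : Agr n (pII σ) (pII τ) := by
  intro s hs
  have he : ∀ A B, ev σ s A B = ev τ s A B := ev_loc h hs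
  show (if T.len s ≤ K then ev σ s ∅ ∅ else gII σ (evB σ) s) =
    (if T.len s ≤ K then ev τ s ∅ ∅ else gII τ (evB τ) s)
  by_cases hl : T.len s ≤ K
  · rw [if_pos hl, if_pos hl, he]
  · rw [if_neg hl, if_neg hl]
    have : evB σ = evB τ := evB_loc h (by omega)
    rw [this]
    unfold gII
    simp only [he]

theorem QI_EG (G : T.Pos → Set T.Pos → Set T.Pos) : QI K (EG C K G) where
  low := fun t ht => ht.1
  par := fun t ht hl => hered_par ht hl
  ex := fun t ht htn => by
    obtain ⟨t', hc, -, h'⟩ := R_nopp (SS K) (UG C K G) true t ht.1 (hered_mem ht)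
      (by rw [tn_true]; rw [tn_false] at htn; omega)
    exact ⟨t', hc, hered_ch hc ht h'⟩
  all := fun t ht htn t' hc => hered_ch hc ht (R_nmine (SS K) (UG C K G) true t ht.1 (hered_mem ht)
      (by rw [tn_true]; rw [tn_false] at htn; omega) t' hc)

theorem pII_lift (σ : Strat (UT C hK)) (x : Play T) (hx : Cons true (pII σ) x) :
    ∃ y : Play (UT C hK), Cons true σ y ∧ (Upr C hK).play y = x := by
  have hK' := hK
  have hlo : ∀ n, n ≤ K → tn true n → x.x (n+1) = ev σ (x.x n) ∅ ∅ := by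
    intro n hn ht
    rw [hx n ht]
    exact if_pos (by rw [x.len]; exact hn)
  have hhi : ∀ n, K < n → tn true n → x.x (n+1) = gII σ (evB σ) (x.x n) := by
    intro n hn ht
    rw [hx n ht]
    exact if_neg (by rw [x.len]; omega)
  have hc1 : tn true (K+1) := by rw [tn_true]; omega
  have ht1 : ¬ tn true K := by rw [tn_true]; omega
  generalize hG : evB σ = G at hhi
  by_cases h : ∃ n, K + 2 ≤ n ∧ x.x n ∈ UG C K G
  · obtain ⟨h0, hu⟩ := Nat.find_spec h
    have hmin : ∀ j, K + 2 ≤ j → j < Nat.find h → x.x j ∉ UG C K G :=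
      fun j h1 h2 h3 => Nat.find_min h h2 ⟨h1, h3⟩
    generalize Nat.find h = n0 at h0 hu hmin
    obtain ⟨w1, w2, w3, w4, w5⟩ := wit_spec hu
    refine lift_u true σ x (wit C K G (x.x n0)) w2 n0 h0 w3 w4 hlo (fun ht => absurd ht ht1) ?_ ?_
    · intro _
      rw [hG, ← w5, anc_play x (by omega)]
    intro n hn ht
    obtain ⟨h3, h4⟩ := fu_play (UG C K G) x n0 n h0 hu hmin hn
    rw [hhi n (by omega) ht]
    unfold gII
    rw [if_pos h3, h4]
  · push Not at h
    have hnF := nFQ_play (UG C K G) x h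
    have hnU : ∀ n, x.x n ∉ UG C K G := by
      intro n hn
      obtain ⟨A, hA⟩ := id hn
      have := hA.1
      rw [x.len] at this
      exact h n this hn
    have hQ := QI_EG (C := C) (K := K) G
    have final : ∀ j, K + 1 ≤ j → x.x j ∉ EG C K G →
        x.x j ∈ RW (SS K) (UG C K G) true → False := by
      intro j hj hjD hjW
      have hnD : ∀ m, j ≤ m → x.x m ∉ EG C K G := fun m hm h' => hjD (hered_play x h' hj hm)
      have hstep : ∀ n, j ≤ n → tn true n → x.x (n+1) = (Rr (SS K) (UG C K G) true).f (x.x n) := by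
        intro n hn ht
        rw [hhi n (by omega) ht]
        unfold gII
        rw [if_neg (hnF n), if_neg (fun h' => hnD n hn h'.1), if_neg (fun h' => hnD n hn h'.1)]
      refine R_fin (SS K) (UG C K G) true x j ?_ (fun n _ => hnU n) hstep
      intro n hn
      induction n, hn using Nat.le_induction with
      | base => exact hjW
      | succ n hn ih =>
        by_cases ht : tn true n
        · rw [hstep n hn ht]
          exact R_mine _ _ _ _ ih (hnU n) (by rw [x.len]; exact ht)
        · exact R_opp _ _ _ _ ih (hnU n) (by rw [x.len]; exact ht) _ (play_ch x n)
            (show K + 1 ≤ _ by rw [x.len]; omega)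
    have hE1 : x.x (K+1) ∈ EG C K G := by
      by_contra hn
      refine final (K+1) le_rfl hn ?_
      by_contra hn'
      exact hn (hered_root (x.len _) hn')
    have hx2 : x.x (K+2) = ev σ (x.x (K+1)) (EG C K G) ∅ := by
      rw [hhi (K+1) (by omega) hc1]
      unfold gII
      rw [if_neg (hnF _), if_pos ⟨hE1, x.len _⟩]
    obtain ⟨hVB, hB2⟩ := ev1 σ (x.x (K+1)) (EG C K G) (V.mk1 (x.len _) hQ hE1) (x.len _)
    rw [← hx2] at hB2
    have hhB : ∀ n, K + 2 ≤ n → tn true n → x.x n ∈ EG C K G → x.x n ∈ evB σ (x.x (K+1)) (EG C K G) →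
        x.x (n+1) = ev σ (x.x n) (EG C K G) (evB σ (x.x (K+1)) (EG C K G)) := by
      intro n hn ht h1 h2
      rw [hG] at h2 ⊢
      rw [hhi n (by omega) ht]
      unfold gII
      rw [anc_play x (by omega), if_neg (hnF n), if_neg (by rw [x.len]; omega), if_pos ⟨h1, h2⟩]
    have hO : O2 C K (EG C K G) (evB σ (x.x (K+1)) (EG C K G)) := by
      rcases hVB with ⟨u, h1, h2, h3, h4⟩ | h'
      · exfalso
        have hanc : anc (K+1) u = x.x (K+1) := by
          rw [h4] at hB2
          have := BU_low hB2 (by rw [x.len]; exact h3)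
          rw [x.len] at this
          rw [← par_anc h3, ← this, x.par]
        have hu : u ∈ UG C K G := ⟨EG C K G, h3, hQ, h1, h2, by rw [hanc, ← hG]; rw [hG]; rw [← h4, hG]⟩
        exact hered_mem h1 (R_U _ _ _ u (show K + 1 ≤ _ by omega) hu)
      · exact h'
    generalize hBe : evB σ (x.x (K+1)) (EG C K G) = B at hVB hB2 hhB hO
    by_cases hD : ∀ j, K + 2 ≤ j → x.x j ∈ B
    · refine lift_play true σ x (EG C K G) B hQ hVB hE1 hD hlo (fun ht => absurd ht ht1)
        (fun _ => ⟨hx2, hBe.symm⟩) ?_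
      intro n hn ht
      exact hhB n hn ht (hO.1 (hD n hn)) (hD n hn)
    · exfalso
      push Not at hD
      have hspec := Nat.find_spec hD
      have hmin : ∀ i, K + 2 ≤ i → i < Nat.find hD → x.x i ∈ B := by
        intro i h1 h2
        by_contra h3
        exact Nat.find_min hD h2 ⟨h1, h3⟩
      generalize Nat.find hD = j at hspec hmin
      obtain ⟨hj, hjD⟩ := hspec
      have hj2 : j ≠ K + 2 := by
        rintro rfl
        exact hjD hB2
      obtain ⟨i, rfl⟩ : ∃ i, j = i + 1 := ⟨j - 1, by omega⟩
      have hi := hmin i (by omega) (by omega)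
      by_cases ht : tn true i
      · apply hjD
        rw [hhB i (by omega) ht (hO.1 hi) hi]
        exact ev2 σ _ _ _ (V.mk2 hQ hVB hi) (by rw [x.len]; omega)
      · have ht' : tn false (T.len (x.x i)) := by
          rw [tn_true] at ht
          rw [x.len, tn_false]; omega
        have hnE : x.x (i+1) ∉ EG C K G := fun h' =>
          hjD (hO.2.2.2 _ hi ht' _ (play_ch x i) h')
        refine final (i+1) (by omega) hnE ?_
        by_contra hn
        exact hnE (hered_ch (play_ch x i) (hO.1 hi) hn)

end unr

noncomputable def UCov {T : GT} (C : Set T.Pos) {K : ℕ} (hK : K % 2 = 0) (k : ℕ) (hk : k ≤ K) : Cov k (UT C hK) T where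
  h := Upr C hK
  φ := fun p σ => cond p (pII σ) (pI σ)
  loc := fun p n σ τ h => by
    cases p
    · exact pI_loc n σ τ h
    · exact pII_loc n σ τ h
  idk := fun p σ q hq => by
    have hq' : T.len (UP.s q) < k := hq
    have h0 := (UP.v q).v0 (by omega)
    have e : ev σ (UP.s q) ∅ ∅ = UP.s (σ.f q) := by
      have hv : V C K (UP.s q) ∅ ∅ := V.mk0 (by omega)
      unfold ev
      rw [dif_pos hv]
      exact congrArg (fun q => UP.s (σ.f q)) (UP.ext' rfl h0.1.symm h0.2.symm)
    cases p
    · exact (if_pos (by show T.len (UP.s q) ≤ K; omega)).trans e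
    · exact (if_pos (by show T.len (UP.s q) ≤ K; omega)).trans e
  inj := fun q q' hq e => by
    have hq' : T.len (UP.s q) ≤ k := hq
    have e' : UP.s q = UP.s q' := e
    have h0 := (UP.v q).v0 (by omega)
    have h1 := (UP.v q').v0 (by rw [← e']; omega)
    exact UP.ext' e' (h0.1.trans h1.1.symm) (h0.2.trans h1.2.symm)
  surj := fun s hs => ⟨(⟨s, ∅, ∅, V.mk0 (by omega)⟩ : UP C K), rfl⟩
  lift := fun p σ x hx => by
    cases p
    · exact pI_lift σ x hx
    · exact pII_lift σ x hx

theorem openUnravel : OpenUnravel := by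
  intro T A hA k
  let C : Set T.Pos := {s | ∃ y : Play T, y ∉ A ∧ y.x (T.len s) = s}
  have hCA : ∀ (x : Play T) (n : ℕ), x.x n ∉ C → x ∈ A := by
    intro x n hn
    by_contra hx
    exact hn ⟨x, hx, by rw [x.len]⟩
  have hAC : ∀ (x : Play T) (m : ℕ), (∀ n, m ≤ n → x.x n ∈ C) → x ∉ A := by
    intro x m h hx
    obtain ⟨n, hn⟩ := hA x hx
    obtain ⟨y, hy, e⟩ := h (max m n) (le_max_left _ _)
    rw [x.len] at e
    refine hy (hn y ?_)
    rw [← anc_play y (le_max_right m n), e, anc_play x (le_max_right m n)]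
  have hK : (2 * k) % 2 = 0 := by omega
  refine ⟨UT C hK, UCov C hK k (by omega), ?_⟩
  have hB : ∀ (y : Play (UT C hK)) (n : ℕ), 2 * k + 2 ≤ n → UP.B (y.x n) = UP.B (y.x (2*k+2)) := by
    intro y n hn
    induction n, hn using Nat.le_induction with
    | base => rfl
    | succ n hn ih =>
      rw [← ih]
      exact uch_B (play_ch y n) (by
        have : T.len (UP.s (y.x n)) = n := y.len n
        omega)
  have hl : ∀ (y : Play (UT C hK)) n, T.len (UP.s (y.x n)) = n := fun y n => y.len n
  have hin : ∀ (y : Play (UT C hK)) (n : ℕ), 2 * k + 2 ≤ n → UP.s (y.x n) ∈ UP.B (y.x (2*k+2)) := by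
    intro y n hn
    rw [← hB y n hn]
    exact ((UP.v (y.x n)).v2 (by rw [hl]; exact hn)).2.2
  have key : ∀ y : Play (UT C hK), y ∈ (Upr C hK).play ⁻¹' A ↔
      ¬ O2 C (2*k) (UP.A (y.x (2*k+2))) (UP.B (y.x (2*k+2))) := by
    intro y
    constructor
    · intro hy hO
      exact hAC _ (2*k+2) (fun n hn => hO.2.1 (hin y n hn)) hy
    · intro hn
      rcases ((UP.v (y.x (2*k+2))).v2 (by rw [hl])).2.1 with ⟨u, -, h2, h3, h4⟩ | h
      · have := hin y (T.len u) h3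
        rw [h4] at this
        have e := BU_low this (by rw [hl])
        rw [hl, anc_self] at e
        refine hCA _ (T.len u) ?_
        show UP.s (y.x (T.len u)) ∉ C
        rw [e]; exact h2
      · exact absurd h hn
  constructor
  · intro y hy
    refine ⟨2*k+2, fun z hz => ?_⟩
    have := (key y).1 hy
    rw [← hz] at this
    exact (key z).2 this
  · intro y hy
    refine ⟨2*k+2, fun z hz hz' => hy ?_⟩
    have := (key z).1 hz'
    rw [hz] at this
    exact (key y).2 this

end BD

namespace BD

section fin
variable {I O : Type} [Inhabited I] [Inhabited O]

def GG (I O : Type) [Inhabited O] : GT where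
  Pos := List (List I × O)
  len := List.length
  par := List.tail
  len_par := fun s => by simp
  next := fun s => ([], default) :: s
  par_next := fun s => rfl
  len_next := fun s => rfl

def hd (s : List (List I × O)) : List I × O := s.headD ([], default)

noncomputable def nrm (f : ℕ → ℕ) (i : ℕ) (l : List I) : List I :=
  if l.length = f i then l else List.replicate (f i) default

theorem nrm_length (f : ℕ → ℕ) (i : ℕ) (l : List I) : (nrm f i l).length = f i := by
  unfold nrm; split_ifs with h
  · exact h
  · simp

theorem nrm_eq (f : ℕ → ℕ) (i : ℕ) (l : List I) (h : l.length = f i) : nrm f i l = l := if_pos h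

noncomputable def uo (f : ℕ → ℕ) (x : Play (GG I O)) (i : ℕ) : List I :=
  nrm f i (hd (x.x (2*i+1) : List (List I × O))).1

def vo (x : Play (GG I O)) (i : ℕ) : O := (hd (x.x (2*i+2) : List (List I × O))).2

noncomputable def EE (f : ℕ → ℕ) (x : Play (GG I O)) : (ℕ → I) × (ℕ → O) :=
  (outcomeI (uo f x), vo x)

theorem play_eq_of_le {T : GT} {x y : Play T} {n m : ℕ} (h : m ≤ n) (e : x.x n = y.x n) :
    x.x m = y.x m := by
  rw [← anc_play x h, e, anc_play y h]

theorem outcomeI_congr {u w : ℕ → List I} {n : ℕ} (h : ∀ j, j ≤ n → u j = w j) :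
    outcomeI u n = outcomeI w n := by
  unfold outcomeI
  congr 3
  funext j
  exact h _ (by omega)

theorem pi_nhd {J : Type} [TopologicalSpace J] (U : Set (ℕ → J)) (hU : IsOpen U)
    (a : ℕ → J) (ha : a ∈ U) : ∃ n, ∀ b : ℕ → J, (∀ i, i < n → b i = a i) → b ∈ U := by
  obtain ⟨s, u, h1, h2⟩ := isOpen_pi_iff.1 hU a ha
  refine ⟨s.sup id + 1, fun b hb => h2 ?_⟩
  intro i hi
  rw [hb i (by have := Finset.le_sup (f := id) hi; simp only [id] at this; omega)]
  exact (h1 i hi).2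

theorem EE_open [TopologicalSpace I] [TopologicalSpace O] (f : ℕ → ℕ)
    (L : Set ((ℕ → I) × (ℕ → O))) (hL : IsOpen L) : IsOp (EE f ⁻¹' L) := by
  intro x hx
  obtain ⟨U, W, hU, hW, h1, h2, h3⟩ := isOpen_prod_iff.1 hL _ _ hx
  obtain ⟨n, hn⟩ := pi_nhd U hU _ h1
  obtain ⟨m, hm⟩ := pi_nhd W hW _ h2
  refine ⟨2*(n+m)+2, fun y hy => h3 ⟨hn _ fun i hi => ?_, hm _ fun i hi => ?_⟩⟩
  · refine outcomeI_congr fun j hj => ?_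
    unfold uo
    rw [play_eq_of_le (m := 2*j+1) (by omega) hy]
  · show vo y i = vo x i
    unfold vo
    rw [play_eq_of_le (m := 2*i+2) (by omega) hy]

theorem EE_borel [TopologicalSpace I] [TopologicalSpace O] (f : ℕ → ℕ)
    (L : Set ((ℕ → I) × (ℕ → O))) (hL : MeasurableSet[borel ((ℕ → I) × (ℕ → O))] L) :
    UU (EE f ⁻¹' L) := by
  induction L, hL using MeasurableSpace.generateFrom_induction with
  | hC t ht _ => exact UU_open openUnravel (EE_open f t ht)
  | empty => exact UU_open openUnravel (EE_open f ∅ isOpen_empty)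
  | compl t _ ih => exact UU_compl ih
  | iUnion s _ ih => rw [Set.preimage_iUnion]; exact UU_iUnion openUnravel ih

/-! Player O -/

def sf (σ : Strat (GG I O)) (s : List (List I × O)) : List (List I × O) := σ.f s

theorem sf_len (σ : Strat (GG I O)) (s : List (List I × O)) : (sf σ s).length = s.length + 1 :=
  (σ.ch s).2

theorem sf_tail (σ : Strat (GG I O)) (s : List (List I × O)) : (sf σ s).tail = s :=
  (σ.ch s).1

noncomputable def posB (σ : Strat (GG I O)) (b : ℕ → List I) : ℕ → List (List I × O)
  | 0 => []
  | i+1 => sf σ ((b i, default) :: posB σ b i)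

theorem posB_congr (σ : Strat (GG I O)) {b c : ℕ → List I} (i : ℕ) (h : ∀ j, j < i → b j = c j) :
    posB σ b i = posB σ c i := by
  induction i with
  | zero => rfl
  | succ i ih =>
    unfold posB
    rw [ih (fun j hj => h j (by omega)), h i (by omega)]

def FF (f : ℕ → ℕ) (j : ℕ) : ℕ := ∑ k ∈ Finset.range j, f k

theorem FF_mono (f : ℕ → ℕ) (hf : ∀ i, 0 < f i) : StrictMono (FF f) :=
  strictMono_nat_of_lt_succ fun n => by
    unfold FF; rw [Finset.sum_range_succ]; have := hf n; omega

theorem inputs_succ (u : ℕ → List I) (i : ℕ) : inputsUpTo u (i+1) = inputsUpTo u i ++ u (i+1) := by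
  unfold inputsUpTo
  rw [List.ofFn_succ_last]
  simp

theorem inputs_zero (u : ℕ → List I) : inputsUpTo u 0 = u 0 := by
  unfold inputsUpTo; simp

theorem inputs_length (f : ℕ → ℕ) (u : ℕ → List I) (hu : ∀ i, (u i).length = f i) (i : ℕ) :
    (inputsUpTo u i).length = FF f (i+1) := by
  induction i with
  | zero => rw [inputs_zero, hu]; simp [FF]
  | succ i ih => rw [inputs_succ, List.length_append, ih, hu]; unfold FF; rw [Finset.sum_range_succ _ (i+1)]

theorem inputs_block (f : ℕ → ℕ) (hf : ∀ i, 0 < f i) (u : ℕ → List I) (hu : ∀ i, (u i).length = f i)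
    (i j : ℕ) (hj : j ≤ i) : ((inputsUpTo u i).drop (FF f j)).take (f j) = u j := by
  induction i with
  | zero =>
    obtain rfl : j = 0 := by omega
    rw [inputs_zero]; simp [FF, ← hu]
  | succ i ih =>
    rw [inputs_succ]
    rcases Nat.lt_or_ge i j with h | h
    · obtain rfl : j = i + 1 := by omega
      rw [← inputs_length f u hu i, List.drop_left, ← hu, List.take_length]
    · rw [← ih h]
      have h1 := inputs_length f u hu i
      have h2 : FF f (j+1) ≤ FF f (i+1) := (FF_mono f hf).monotone (by omega)
      have h3 : FF f (j+1) = FF f j + f j := by unfold FF; rw [Finset.sum_range_succ]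
      rw [List.drop_append_of_le_length (by omega), List.take_append_of_le_length (by simp; omega)]

noncomputable def sO (f : ℕ → ℕ) (σ : Strat (GG I O)) (l : List I) : O :=
  if h : ∃ i, FF f (i+1) = l.length then
    (hd (posB σ (fun j => (l.drop (FF f j)).take (f j)) (h.choose+1))).2
  else default

theorem sO_eq (f : ℕ → ℕ) (hf : ∀ i, 0 < f i) (σ : Strat (GG I O)) (u : ℕ → List I)
    (hu : ∀ i, (u i).length = f i) (i : ℕ) :
    sO f σ (inputsUpTo u i) = (hd (posB σ u (i+1))).2 := by
  have h : ∃ j, FF f (j+1) = (inputsUpTo u i).length := ⟨i, (inputs_length f u hu i).symm⟩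
  unfold sO
  rw [dif_pos h]
  have e : h.choose = i := by
    have := (FF_mono f hf).injective (h.choose_spec.trans (inputs_length f u hu i))
    omega
  rw [e, posB_congr σ (i+1) (fun j hj => inputs_block f hf u hu i j (by omega))]

/-- The play built from moves `m` by one player and `σ` for parity `p`. -/
noncomputable def bx (p : Bool) (σ : Strat (GG I O)) (m : ℕ → List I × O) : ℕ → List (List I × O)
  | 0 => []
  | n+1 => if tn p n then sf σ (bx p σ m n) else m n :: bx p σ m n

noncomputable def bp (p : Bool) (σ : Strat (GG I O)) (m : ℕ → List I × O) : Play (GG I O) where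
  x := bx p σ m
  len := fun n => by
    induction n with
    | zero => rfl
    | succ n ih =>
      show List.length (bx p σ m (n+1)) = n+1
      have ih' : List.length (bx p σ m n) = n := ih
      unfold bx
      split_ifs
      · rw [sf_len, ih']
      · simp [ih']
  par := fun n => by
    show List.tail (bx p σ m (n+1)) = bx p σ m n
    conv_lhs => unfold bx
    split_ifs
    · exact sf_tail σ _
    · rfl

theorem bp_cons (p : Bool) (σ : Strat (GG I O)) (m : ℕ → List I × O) : Cons p σ (bp p σ m) :=
  fun n hn => if_pos hn

theorem bx_B (σ : Strat (GG I O)) (u : ℕ → List I) (i : ℕ) :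
    bx true σ (fun n => (u (n/2), default)) (2*i) = posB σ u i := by
  induction i with
  | zero => rfl
  | succ i ih =>
    show bx true σ _ (2*i+1+1) = _
    rw [bx, if_pos (by rw [tn_true]; omega), bx, if_neg (by rw [tn_true]; omega), ih]
    have : 2*i/2 = i := by omega
    rw [this]; rfl

theorem winO (f : ℕ → ℕ) (hf : ∀ i, 0 < f i) (L : Set ((ℕ → I) × (ℕ → O))) (σ : Strat (GG I O))
    (h : ∀ x, Cons true σ x → x ∈ EE f ⁻¹' L) : delayWinO f L (sO f σ) := by
  intro u v hu hv
  have := h _ (bp_cons true σ (fun n => (u (n/2), default)))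
  have e : EE f (bp true σ (fun n => (u (n/2), default))) = (outcomeI u, v) := by
    unfold EE
    congr 1
    · congr 1
      funext i
      show nrm f i (hd (bx true σ (fun n => (u (n/2), default)) (2*i+1))).1 = u i
      rw [bx, if_neg (by rw [tn_true]; omega)]
      have : 2*i/2 = i := by omega
      rw [this]
      exact nrm_eq f i _ (hu i)
    · funext i
      rw [hv, sO_eq f hf σ u hu, ← bx_B]
      rfl
  rw [← e]; exact this

/-! Player I -/

noncomputable def posI (σ : Strat (GG I O)) : List O → List (List I × O)
  | [] => []
  | b :: w => ([], b) :: sf σ (posI σ w)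

noncomputable def tI (f : ℕ → ℕ) (σ : Strat (GG I O)) (w : List O) : List I :=
  nrm f w.length (hd (sf σ (posI σ w.reverse))).1

theorem prefixW_succ (v : ℕ → O) (i : ℕ) : (prefixW v (i+1)).reverse = v i :: (prefixW v i).reverse := by
  unfold prefixW
  rw [List.ofFn_succ_last]
  simp

theorem bx_I (σ : Strat (GG I O)) (v : ℕ → O) (i : ℕ) :
    bx false σ (fun n => ([], v (n/2))) (2*i) = posI σ (prefixW v i).reverse := by
  induction i with
  | zero => simp [prefixW, posI, bx]
  | succ i ih =>
    show bx false σ _ (2*i+1+1) = _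
    rw [bx, if_neg (by rw [tn_false]; omega), bx, if_pos (by rw [tn_false]; omega), ih, prefixW_succ]
    have : (2*i+1)/2 = i := by omega
    rw [this]; rfl

theorem winI (f : ℕ → ℕ) (L : Set ((ℕ → I) × (ℕ → O))) (σ : Strat (GG I O))
    (h : ∀ x, Cons false σ x → x ∉ EE f ⁻¹' L) : delayWinI f L (tI f σ) := by
  intro u v hu hv
  have := h _ (bp_cons false σ (fun n => ([], v (n/2))))
  have e : EE f (bp false σ (fun n => ([], v (n/2)))) = (outcomeI u, v) := by
    unfold EE
    congr 1
    · congr 1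
      funext i
      show nrm f i (hd (bx false σ (fun n => ([], v (n/2))) (2*i+1))).1 = u i
      rw [bx, if_pos (by rw [tn_false]; omega), bx_I, hv, tI]
      simp [prefixW]
    · funext i
      show (hd (bx false σ (fun n => ([], v (n/2))) (2*i+1+1))).2 = v i
      rw [bx, if_neg (by rw [tn_false]; omega)]
      have : (2*i+1)/2 = i := by omega
      rw [this]; rfl
  rw [← e]; exact this

end fin
end BD


/-- every delay game with a Borel winning condition is determined. -/
theorem stmt10 {I O : Type} [Fintype I] [Fintype O] [Inhabited I]
    [TopologicalSpace I] [DiscreteTopology I]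
    [TopologicalSpace O] [DiscreteTopology O]
    (f : ℕ → ℕ) (hf : ∀ i, 0 < f i)
    (L : Set ((ℕ → I) × (ℕ → O)))
    (hL : MeasurableSet[borel ((ℕ → I) × (ℕ → O))] L) :
    (∃ σ : List I → O, delayWinO f L σ) ∨
      (∃ τ : List O → List I, delayStratI f τ ∧ delayWinI f L τ) := by
  rcases isEmpty_or_nonempty O with hO | ⟨⟨o⟩⟩
  · exact Or.inr ⟨fun w => List.replicate (f w.length) default, fun w => by simp,
      fun u v _ _ => (hO.false (v 0)).elim⟩
  · have : Inhabited O := ⟨o⟩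
    rcases BD.det_UU (BD.GG I O) ([] : List (List I × O)) rfl
      (fun s hs => List.eq_nil_of_length_eq_zero hs) _ (BD.EE_borel f L hL) with ⟨σ, h⟩ | ⟨σ, h⟩
    · exact Or.inl ⟨_, BD.winO f hf L σ h⟩
    · exact Or.inr ⟨_, fun w => BD.nrm_length f _ _, BD.winI f L σ h⟩
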